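/- arXiv:1206.6019 — 3 statements merged into one kernel-verified Lean document; each statement's English description precedes it below -/
import Mathlib

section
/- Let X be a smooth complex projective Calabi-Yau variety of dimension d ≥ 2 and let E and F be spherical objects of D(X) such that the spherical twists Φ_E and Φ_F are not isomorphic as functors. If Φ_E ∘ Φ_F ≅ Φ_F ∘ Φ_E, then Hom(E, F[i]) = 0 for every integer i (i.e. F lies in the orthogonal complement E^⊥). -/
/-!
This file formalizes a statement from "Commuting reflection functors and
orthogonal spherical objects".  Mathlib does not have bounded derived categories
of coherent sheaves on smooth projective varieties, so the geometric setting is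
axiomatized: `T` plays the role of the bounded derived category `D(X)` of a
smooth complex projective variety `X` — a ℂ-linear triangulated category with
finite-dimensional, bounded graded Hom's — and the Calabi-Yau condition is
expressed by Serre duality in the form of a perfect trace pairing
`Hom(A,B) × Hom(B,A⟦d⟧) → ℂ`.
-/

open CategoryTheory Limits Pretriangulated Module

universe v u

namespace SphericalPaper

variable (T : Type u) [Category.{v} T] [Preadditive T] [Linear ℂ T]
  [HasZeroObject T] [HasShift T ℤ] [∀ n : ℤ, (shiftFunctor T n).Additive]
  [Pretriangulated T] [HasFiniteBiproducts T]

/-- Hom-finiteness and boundedness of the graded Hom's, as holds in the bounded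
derived category of coherent sheaves on a smooth complex projective variety. -/
class HomFiniteBounded : Prop where
  finite : ∀ A B : T, FiniteDimensional ℂ (A ⟶ B)
  bounded : ∀ A B : T, ∃ N : ℕ, ∀ i : ℤ, (N : ℤ) < |i| → ∀ f : A ⟶ B⟦i⟧, f = 0

/-- The Calabi-Yau condition in dimension `d`: the `d`-th shift is a Serre
functor, expressed by trace functionals inducing a perfect pairing
`Hom(A,B) × Hom(B,A⟦d⟧) → ℂ` (Serre duality `Hom(A,B) ≅ Hom(B,A⟦d⟧)^*`). -/
class CalabiYau (d : ℤ) : Type (max u v) where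
  tr : ∀ A : T, (A ⟶ A⟦d⟧) →ₗ[ℂ] ℂ
  nondegen_left : ∀ (A B : T) (f : A ⟶ B),
    (∀ g : B ⟶ A⟦d⟧, tr A (f ≫ g) = 0) → f = 0
  nondegen_right : ∀ (A B : T) (g : B ⟶ A⟦d⟧),
    (∀ f : A ⟶ B, tr A (f ≫ g) = 0) → g = 0

variable {T}

/-- An object `E` is spherical (for dimension `d`) if `Hom(E,E⟦i⟧)` is
one-dimensional for `i = 0` and `i = d` and vanishes for all other `i`. -/
def IsSpherical (d : ℤ) (E : T) : Prop :=
  finrank ℂ (E ⟶ E⟦(0 : ℤ)⟧) = 1 ∧ finrank ℂ (E ⟶ E⟦d⟧) = 1 ∧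
    ∀ i : ℤ, i ≠ 0 → i ≠ d → ∀ f : E ⟶ E⟦i⟧, f = 0

/-- The spherical twist `Φ_E` attached to a spherical object `E`, presented by
its defining natural distinguished triangle
`Φ_E(G) → RHom(E,G) ⊗_ℂ E → G → Φ_E(G)[1]` :
`Φ` is a triangulated autoequivalence, `Ψ` is the functor `G ↦ RHom(E,G) ⊗_ℂ E`
(each `Ψ(G)` is exhibited as a finite biproduct of shifts `E⟦-i⟧` indexed by
bases of the spaces `Hom(E,G⟦i⟧)`, the natural map `Ψ(G) → G` restricting to
evaluation of the corresponding basis vectors, i.e. it is the evaluation map,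
which is the Fourier-Mukai description of the twist along the spherical
object). -/
structure SphericalTwist (E : T) where
  Φ : T ⥤ T
  equiv : Φ.IsEquivalence
  commShift : Φ.CommShift ℤ
  triangulated : letI := commShift; Φ.IsTriangulated
  Ψ : T ⥤ T
  α : Φ ⟶ Ψ
  ε : Ψ ⟶ 𝟭 T
  δ : 𝟭 T ⟶ Φ ⋙ shiftFunctor T (1 : ℤ)
  dist : ∀ G : T, Triangle.mk (α.app G) (ε.app G) (δ.app G) ∈ distTriang T
  m : T → ℕ
  deg : ∀ G : T, Fin (m G) → ℤ
  decomp : ∀ G : T, Ψ.obj G ≅ ⨁ (fun p : Fin (m G) => E⟦-(deg G p)⟧)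
  bas : ∀ (G : T) (n : ℤ), Basis {p : Fin (m G) // deg G p = n} ℂ (E ⟶ G⟦n⟧)
  eval : ∀ (G : T) (p : Fin (m G)),
    biproduct.ι (fun q : Fin (m G) => E⟦-(deg G q)⟧) p ≫ (decomp G).inv ≫ ε.app G =
      ((shiftEquiv' T (-(deg G p)) (deg G p) (neg_add_cancel _)).toAdjunction.homEquiv
        E G).symm (bas G (deg G p) ⟨p, rfl⟩)

set_option linter.unusedSectionVars false

/-- There are no nonzero morphisms from `X` to `Y`. -/
def HomZero (X Y : T) : Prop := ∀ f : X ⟶ Y, f = 0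

theorem HomZero.of_iso_left {X X' Y : T} (h : HomZero X Y) (e : X' ≅ X) : HomZero X' Y :=
  fun f => by rw [← cancel_epi e.inv, h (e.inv ≫ f), comp_zero]

theorem HomZero.of_iso_right {X Y Y' : T} (h : HomZero X Y) (e : Y' ≅ Y) : HomZero X Y' :=
  fun f => by rw [← cancel_mono e.hom, h (f ≫ e.hom), zero_comp]

theorem HomZero.map {X Y : T} (h : HomZero X Y) (G : T ⥤ T) [G.IsEquivalence] :
    HomZero (G.obj X) (G.obj Y) := fun f => by
  obtain ⟨g, rfl⟩ := G.map_surjective f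
  rw [h g, G.map_zero]

theorem HomZero.of_map {X Y : T} (G : T ⥤ T) [G.IsEquivalence]
    (h : HomZero (G.obj X) (G.obj Y)) : HomZero X Y := fun f =>
  G.map_injective (by rw [h (G.map f), G.map_zero])

theorem HomZero.biproduct_right {X : T} {m : ℕ} {Y : Fin m → T} (h : ∀ q, HomZero X (Y q)) :
    HomZero X (⨁ Y) := fun _ => biproduct.hom_ext _ _ fun q => by rw [h q (_ ≫ _), zero_comp]

theorem comp_eq_zero_of_biproduct {X Z : T} {m : ℕ} {Y : Fin m → T} (a : X ⟶ ⨁ Y)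
    (b : ⨁ Y ⟶ Z) (h : ∀ q, HomZero X (Y q) ∨ HomZero (Y q) Z) : a ≫ b = 0 := by
  rw [← Category.id_comp b, ← biproduct.total, Preadditive.sum_comp, Preadditive.comp_sum]
  refine Finset.sum_eq_zero fun q _ => ?_
  rcases h q with h | h
  · rw [Category.assoc, ← Category.assoc, h (a ≫ _), zero_comp]
  · rw [Category.assoc, h (_ ≫ b), comp_zero, comp_zero]

/-- The composite of two shifts, as an isomorphism of objects. -/
noncomputable def shiftShiftIso (X : T) (a b c : ℤ) (h : a + b = c) : X⟦a⟧⟦b⟧ ≅ X⟦c⟧ :=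
  ((shiftFunctorAdd' T a b c h).app X).symm

theorem homZero_shift_iff {X Y : T} {a b a' b' : ℤ} (h : b - a = b' - a') :
    HomZero (X⟦a⟧) (Y⟦b⟧) ↔ HomZero (X⟦a'⟧) (Y⟦b'⟧) :=
  ⟨fun H => ((H.map (shiftFunctor T (a' - a))).of_iso_left
      (shiftShiftIso X a (a' - a) a' (by ring)).symm).of_iso_right
      (shiftShiftIso Y b (a' - a) b' (by linarith)).symm,
   fun H => ((H.map (shiftFunctor T (a - a'))).of_iso_left
      (shiftShiftIso X a' (a - a') a (by ring)).symm).of_iso_right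
      (shiftShiftIso Y b' (a - a') b (by linarith)).symm⟩

theorem homZero_shift_left {X Y : T} {a b c : ℤ} (h : b - a = c) :
    HomZero (X⟦a⟧) (Y⟦b⟧) ↔ HomZero X (Y⟦c⟧) :=
  (homZero_shift_iff (a' := 0) (b' := c) (by linarith)).trans
    ⟨fun H => H.of_iso_left ((shiftFunctorZero T ℤ).app X).symm,
     fun H => H.of_iso_left ((shiftFunctorZero T ℤ).app X)⟩

theorem homZero_shift_right {X Y : T} {a b c : ℤ} (h : a - b = c) :
    HomZero (X⟦a⟧) (Y⟦b⟧) ↔ HomZero (X⟦c⟧) Y :=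
  (homZero_shift_iff (a' := c) (b' := 0) (by linarith)).trans
    ⟨fun H => H.of_iso_right ((shiftFunctorZero T ℤ).app Y).symm,
     fun H => H.of_iso_right ((shiftFunctorZero T ℤ).app Y)⟩

theorem HomZero.shift_biproduct {X : T} {m : ℕ} {Y : Fin m → T} {n : ℤ}
    (h : ∀ q, HomZero X ((Y q)⟦n⟧)) : HomZero X ((⨁ Y)⟦n⟧) := by
  rw [← homZero_shift_left (show 0 - (-n) = n by ring), homZero_shift_right (c := -n) (by ring)]
  refine HomZero.biproduct_right fun q => ?_
  rw [← homZero_shift_right (b := 0) (sub_zero _), homZero_shift_left (c := n) (by ring)]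
  exact h q

/-- Serre duality, at the level of vanishing. -/
theorem HomZero.dual (d : ℤ) [CalabiYau T d] {E X : T} {m n : ℤ} (hm : m - d = n)
    (h : HomZero (E⟦n⟧) X) : HomZero X (E⟦m⟧) := fun f => by
  refine CalabiYau.nondegen_left (d := d) _ _ f fun g => ?_
  rw [(homZero_shift_right hm).2 h g, comp_zero, map_zero]

theorem IsSpherical.homZero {d : ℤ} {E : T} (hE : IsSpherical d E) {a b : ℤ} (h0 : b - a ≠ 0)
    (h1 : b - a ≠ d) : HomZero (E⟦a⟧) (E⟦b⟧) :=
  (homZero_shift_left rfl).2 (hE.2.2 _ h0 h1)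

theorem exists_factor_of_connecting {A B C Z : T} {α : A ⟶ B} {ε : B ⟶ C} {δ : C ⟶ A⟦(1 : ℤ)⟧}
    (hT : Triangle.mk α ε δ ∈ distTriang T) (Δ : A ⟶ Z) (h : δ ≫ Δ⟦(1 : ℤ)⟧' = 0) :
    ∃ y : B ⟶ Z, Δ = α ≫ y := by
  obtain ⟨g, hg⟩ := Triangle.yoneda_exact₃ _ (rot_of_distTriang _ hT) (Δ⟦(1 : ℤ)⟧') h
  obtain ⟨y, rfl⟩ := (shiftFunctor T (1 : ℤ)).map_surjective g
  change B ⟶ Z at y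
  refine ⟨-y, (shiftFunctor T (1 : ℤ)).map_injective (hg.trans ?_)⟩
  rw [Functor.map_comp, Functor.map_neg, Preadditive.comp_neg]
  exact Preadditive.neg_comp _ _

/-- `E⟦k⟧` has nonzero morphisms to `X` only for `k` in the set `A`. -/
def Supp (E : T) (A : ℤ → Prop) (X : T) : Prop := ∀ k, ¬ A k → HomZero (E⟦k⟧) X

theorem Supp.mono {E X : T} {A B : ℤ → Prop} (h : Supp E A X) (hAB : ∀ k, A k → B k) :
    Supp E B X := fun k hk => h k fun hA => hk (hAB k hA)

/-- The features of a spherical twist along `E` that depend only on the orbit of `E` under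
shifts. -/
structure TwistTriangle (E : T) (d : ℤ) where
  Φ : T ⥤ T
  equiv : Φ.IsEquivalence
  Ψ : T ⥤ T
  α : Φ ⟶ Ψ
  ε : Ψ ⟶ 𝟭 T
  δ : 𝟭 T ⟶ Φ ⋙ shiftFunctor T (1 : ℤ)
  dist : ∀ G : T, Triangle.mk (α.app G) (ε.app G) (δ.app G) ∈ distTriang T
  decomp : ∀ G : T, ∃ (m : ℕ) (k : Fin m → ℤ), Nonempty (Ψ.obj G ≅ ⨁ fun q => E⟦k q⟧)
  act : ∀ k : ℤ, Nonempty (Φ.obj (E⟦k⟧) ≅ E⟦k - d⟧)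

attribute [instance] TwistTriangle.equiv

section Push

variable {E : T} {d : ℤ}

/-- `f : X ⟶ X₁` is obtained by coning off all the morphisms `E⟦k⟧ ⟶ X` with `k ≤ p`. -/
def IsPush (E : T) (d p : ℤ) {X X₁ : T} (f : X ⟶ X₁) : Prop :=
  (∃ (m : ℕ) (k : Fin m → ℤ) (w : ⨁ (fun q => E⟦k q⟧) ⟶ X)
    (g : X₁ ⟶ (⨁ fun q => E⟦k q⟧)⟦(1 : ℤ)⟧), Triangle.mk w f g ∈ distTriang T ∧
      ∀ q, k q ≤ p ∧ ¬ HomZero (E⟦k q⟧) X) ∧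
  (∀ k ≤ p, ∀ c : E⟦k⟧ ⟶ X, c ≫ f = 0) ∧
  ∀ k, ¬ HomZero (E⟦k⟧) X₁ → (p < k ∧ ¬ HomZero (E⟦k⟧) X) ∨
    (k + d - 1 ≤ p ∧ ¬ HomZero (E⟦k + d - 1⟧) X)

/-- The support of the target of `IsPush`, for a source supported on `A`. -/
def pushSupp (d p : ℤ) (A : ℤ → Prop) (k : ℤ) : Prop :=
  (p < k ∧ A k) ∨ (k + d - 1 ≤ p ∧ A (k + d - 1))

variable {p : ℤ} {A : ℤ → Prop}

theorem IsPush.supp {X X₁ : T} {f : X ⟶ X₁} (hf : IsPush E d p f) (hX : Supp E A X) :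
    Supp E (pushSupp d p A) X₁ := fun k hk => by
  by_contra h
  rcases hf.2.2 k h with ⟨h1, h2⟩ | ⟨h1, h2⟩
  · exact hk (Or.inl ⟨h1, by_contra fun h3 => h2 (hX _ h3)⟩)
  · exact hk (Or.inr ⟨h1, by_contra fun h3 => h2 (hX _ h3)⟩)

theorem IsPush.exists_extension {X X₁ Y Y₁ : T} {f : X ⟶ X₁} {f' : Y ⟶ Y₁}
    (hf : IsPush E d p f) (hf' : IsPush E d p f') (g : X ⟶ Y) :
    ∃ g₁ : X₁ ⟶ Y₁, g ≫ f' = f ≫ g₁ := by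
  obtain ⟨m, k, w, z, hT, hk⟩ := hf.1
  have h0 : w ≫ g ≫ f' = 0 := biproduct.hom_ext' _ _ fun q => by
    have := hf'.2.1 (k q) (hk q).1 (biproduct.ι (fun q => E⟦k q⟧) q ≫ w ≫ g)
    simpa using this
  exact Triangle.yoneda_exact₂ _ hT (g ≫ f') h0

theorem IsPush.cancel {X X₁ Z : T} {f : X ⟶ X₁} (hf : IsPush E d p f) (hX : Supp E A X)
    (G : T ⥤ T) [G.IsEquivalence] (hZ : ∀ k ≤ p, A k → HomZero Z (G.obj (E⟦k⟧)))
    (x : Z ⟶ G.obj X) (hx : x ≫ G.map f = 0) : x = 0 := by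
  obtain ⟨m, k, w, z, hT, hk⟩ := hf.1
  let e := G.objObjPreimageIso Z
  obtain ⟨y, hy⟩ := G.map_surjective (e.hom ≫ x)
  have h0 : y ≫ f = 0 := G.map_injective (by
    rw [G.map_comp, hy, Category.assoc, hx, comp_zero, G.map_zero])
  obtain ⟨y', rfl⟩ := Triangle.coyoneda_exact₂ _ hT y h0
  have hQ : HomZero (G.objPreimage Z) (⨁ fun q => E⟦k q⟧) := HomZero.biproduct_right fun q =>
    HomZero.of_map G ((hZ _ (hk q).1 (by_contra fun h => (hk q).2 (hX _ h))).of_iso_left e)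
  rw [← cancel_epi e.hom, ← hy, comp_zero, ← G.map_zero]
  exact congrArg G.map ((congrArg (· ≫ _) (hQ y')).trans zero_comp)

theorem IsPush.exists_lift {X X₁ Z : T} {f : X ⟶ X₁} (hf : IsPush E d p f) (hX : Supp E A X)
    (G : T ⥤ T) [G.IsEquivalence] (hZ : ∀ k ≤ p, A k → HomZero Z (G.obj (E⟦k + 1⟧)))
    (y : Z ⟶ G.obj X₁) : ∃ x : Z ⟶ G.obj X, x ≫ G.map f = y := by
  obtain ⟨m, k, w, z, hT, hk⟩ := hf.1
  let e := G.objObjPreimageIso Z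
  obtain ⟨y', hy⟩ := G.map_surjective (e.hom ≫ y)
  have hQ : HomZero (G.objPreimage Z) ((⨁ fun q => E⟦k q⟧)⟦(1 : ℤ)⟧) :=
    HomZero.shift_biproduct fun q =>
      (HomZero.of_map G ((hZ _ (hk q).1 (by_contra fun h => (hk q).2 (hX _ h))).of_iso_left
        e)).of_iso_right (shiftShiftIso _ _ _ _ rfl)
  obtain ⟨x : _ ⟶ X, hx⟩ := Triangle.coyoneda_exact₃ _ hT y' (hQ _)
  refine ⟨e.inv ≫ G.map x, ?_⟩
  rw [← cancel_epi e.hom, ← hy, ← Category.assoc, e.hom_inv_id_assoc, hx]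
  exact (G.map_comp x f).symm

end Push

section Fill

variable {E : T} {d : ℤ} (t t' : TwistTriangle E d)

/-- The family `θ` is natural on `S` and compatible with the connecting morphisms. -/
def IsFill (S : T → Prop) (θ : ∀ X, t.Φ.obj X ⟶ t'.Φ.obj X) : Prop :=
  (∀ X, S X → t.δ.app X ≫ (θ X)⟦(1 : ℤ)⟧' = t'.δ.app X) ∧
    ∀ X Y, S X → S Y → ∀ g : X ⟶ Y, t.Φ.map g ≫ θ Y = θ X ≫ t'.Φ.map g

variable {t t'} in
theorem IsFill.mono {S S' : T → Prop} {θ : ∀ X, t.Φ.obj X ⟶ t'.Φ.obj X}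
    (h : IsFill t t' S θ) (hS : ∀ X, S' X → S X) : IsFill t t' S' θ :=
  ⟨fun X hX => h.1 X (hS X hX), fun X Y hX hY => h.2 X Y (hS X hX) (hS Y hY)⟩

/-- Fills exist on the objects supported on `A`, and are unique among fills defined on a
sufficiently large subcategory. -/
def Fillable (A : ℤ → Prop) : Prop :=
  (∃ θ, IsFill t t' (Supp E A) θ) ∧
    ∃ N : ℕ, ∀ θ₁ θ₂, IsFill t t' (Supp E fun k => |k| ≤ N) θ₁ →
      IsFill t t' (Supp E fun k => |k| ≤ N) θ₂ → ∀ X, Supp E A X → θ₁ X = θ₂ X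

theorem TwistTriangle.homZero_shift_obj {X : T} {k j : ℤ} (h : j + d = k)
    (hX : HomZero X (E⟦k⟧)) : HomZero (t.Φ.obj X) (E⟦j⟧) := by
  obtain rfl : j = k - d := by linarith
  exact (hX.map t.Φ).of_iso_right (t.act k).some.symm

theorem TwistTriangle.homZero_obj_shift {X : T} {k j : ℤ} (h : j + d = k)
    (hX : HomZero (E⟦k⟧) X) : HomZero (E⟦j⟧) (t.Φ.obj X) := by
  obtain rfl : j = k - d := by linarith
  exact (hX.map t.Φ).of_iso_left (t.act k).some.symm

theorem exists_shift_fill (hE : IsSpherical d E) (hd : 2 ≤ d) (X : T) :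
    ∃ θ : t.Φ.obj X ⟶ t'.Φ.obj X, t.δ.app X ≫ θ⟦(1 : ℤ)⟧' = t'.δ.app X := by
  obtain ⟨m, k, ⟨i⟩⟩ := t.decomp X
  have h0 : t.ε.app X ≫ t'.δ.app X = 0 := by
    rw [← cancel_epi i.inv, comp_zero]
    refine biproduct.hom_ext' _ _ fun q => ?_
    have hz : HomZero (E⟦k q⟧) ((t'.Φ.obj (E⟦k q⟧))⟦(1 : ℤ)⟧) :=
      (hE.homZero (b := k q - d + 1) (by linarith) (by linarith)).of_iso_right
        ((shiftFunctor T (1 : ℤ)).mapIso (t'.act (k q)).some ≪≫ shiftShiftIso _ _ _ _ rfl)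
    have hn := t'.δ.naturality (biproduct.ι (fun q => E⟦k q⟧) q ≫ i.inv ≫ t.ε.app X)
    simp only [Functor.id_map, Category.assoc] at hn
    rw [comp_zero]
    exact hn.trans ((congrArg (· ≫ _) (hz (t'.δ.app _))).trans zero_comp)
  obtain ⟨g, hg⟩ := Triangle.yoneda_exact₃ _ (t.dist X) (t'.δ.app X) h0
  obtain ⟨θ, rfl⟩ := (shiftFunctor T (1 : ℤ)).map_surjective g
  exact ⟨θ, hg.symm⟩

theorem eq_zero_of_spaced [CalabiYau T d] {A : ℤ → Prop} (hA : ∀ k, A k → ¬ A (k + d)) {X Y : T}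
    (hX : Supp E A X) (hY : Supp E A Y) (Δ : t.Φ.obj X ⟶ t'.Φ.obj Y)
    (h : t.δ.app X ≫ Δ⟦(1 : ℤ)⟧' = 0) : Δ = 0 := by
  obtain ⟨y, hΔ⟩ := exists_factor_of_connecting (t.dist X) Δ h
  obtain ⟨m, k, ⟨i⟩⟩ := t.decomp X
  rw [hΔ, ← Category.id_comp y, ← i.hom_inv_id, Category.assoc, ← Category.assoc]
  refine comp_eq_zero_of_biproduct _ _ fun q => ?_
  by_cases hk : A (k q)
  · exact Or.inr (t'.homZero_obj_shift rfl (hY _ (hA _ hk)))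
  · exact Or.inl (t.homZero_shift_obj rfl (HomZero.dual d (by ring) (hX _ hk)))

theorem IsFill.naturality_connecting {t t' : TwistTriangle E d} {X Y : T}
    {a : t.Φ.obj X ⟶ t'.Φ.obj X} {b : t.Φ.obj Y ⟶ t'.Φ.obj Y}
    (ha : t.δ.app X ≫ a⟦(1 : ℤ)⟧' = t'.δ.app X) (hb : t.δ.app Y ≫ b⟦(1 : ℤ)⟧' = t'.δ.app Y)
    (g : X ⟶ Y) :
    t.δ.app X ≫ (t.Φ.map g ≫ b)⟦(1 : ℤ)⟧' = t.δ.app X ≫ (a ≫ t'.Φ.map g)⟦(1 : ℤ)⟧' := by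
  have h1 := t.δ.naturality g
  have h2 := t'.δ.naturality g
  simp only [Functor.id_map, Functor.comp_map] at h1 h2
  simp only [Functor.map_comp]
  rw [← reassoc_of% h1, hb, reassoc_of% ha, h2]

theorem fillable_of_spaced [CalabiYau T d] (hE : IsSpherical d E) (hd : 2 ≤ d) {A : ℤ → Prop}
    (hA : ∀ k, A k → ¬ A (k + d)) {N : ℕ} (hN : ∀ k, A k → |k| ≤ N) : Fillable t t' A := by
  choose θ hθ using exists_shift_fill t t' hE hd
  refine ⟨⟨θ, fun X _ => hθ X, fun X Y hX hY g => ?_⟩, N, fun θ₁ θ₂ h₁ h₂ X hX => ?_⟩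
  · refine sub_eq_zero.1 (eq_zero_of_spaced t t' hA hX hY _ ?_)
    rw [Functor.map_sub, Preadditive.comp_sub, sub_eq_zero]
    exact IsFill.naturality_connecting (hθ X) (hθ Y) g
  · refine sub_eq_zero.1 (eq_zero_of_spaced t t' hA hX hX _ ?_)
    rw [Functor.map_sub, Preadditive.comp_sub, sub_eq_zero]
    rw [h₁.1 X (hX.mono hN), h₂.1 X (hX.mono hN)]

theorem TwistTriangle.homZero_obj_obj [CalabiYau T d] {X : T} {j k : ℤ} (h : k - d = j)
    (hX : HomZero (E⟦j⟧) X) : HomZero (t.Φ.obj X) (t'.Φ.obj (E⟦k⟧)) :=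
  (t.homZero_shift_obj (by ring) (HomZero.dual d h hX)).of_iso_right (t'.act k).some

theorem TwistTriangle.homZero_obj_shift_one [CalabiYau T d] {X : T} {j k : ℤ}
    (h : k + 1 - 2 * d = j) (hX : HomZero (E⟦j⟧) X) :
    HomZero X ((t.Φ ⋙ shiftFunctor T (1 : ℤ)).obj (E⟦k⟧)) :=
  (HomZero.dual d (m := k - d + 1) (by linarith) hX).of_iso_right
    ((shiftFunctor T (1 : ℤ)).mapIso (t.act k).some ≪≫ shiftShiftIso _ _ _ _ rfl)

theorem Fillable.of_pushSupp [CalabiYau T d] (hd : 2 ≤ d) {p : ℤ} {A : ℤ → Prop}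
    (hpush : ∀ X : T, ∃ (X₁ : T) (f : X ⟶ X₁), IsPush E d p f) {b : ℕ} (hb : ∀ k, A k → |k| ≤ b)
    (hgap : ∀ k ≤ p, A k → ¬ A (k - d) ∧ ¬ A (k + 1 - d) ∧ ¬ A (k + 1 - 2 * d))
    (h : Fillable t t' (pushSupp d p A)) : Fillable t t' A := by
  choose X₁ f hf using hpush
  obtain ⟨⟨θ, hθ⟩, N, hN⟩ := h
  have cancel : ∀ X Y, Supp E A X → Supp E A Y → ∀ x : t.Φ.obj X ⟶ t'.Φ.obj Y,
      x ≫ t'.Φ.map (f Y) = 0 → x = 0 := fun X Y hX hY =>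
    (hf Y).cancel hY t'.Φ fun k hk hA =>
      t.homZero_obj_obj t' rfl (hX _ (hgap k hk hA).1)
  constructor
  · have lift : ∀ X, ∃ x : t.Φ.obj X ⟶ t'.Φ.obj X, Supp E A X →
        x ≫ t'.Φ.map (f X) = t.Φ.map (f X) ≫ θ (X₁ X) := fun X => by
      by_cases hX : Supp E A X
      · obtain ⟨x, hx⟩ := (hf X).exists_lift hX t'.Φ (Z := t.Φ.obj X) (fun k hk hA =>
          t.homZero_obj_obj t' rfl (hX _ (hgap k hk hA).2.1)) (t.Φ.map (f X) ≫ θ (X₁ X))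
        exact ⟨x, fun _ => hx⟩
      · exact ⟨0, fun h => absurd h hX⟩
    choose η hη using lift
    refine ⟨η, fun X hX => ?_, fun X Y hX hY g => ?_⟩
    · refine sub_eq_zero.1 ((hf X).cancel hX (t'.Φ ⋙ shiftFunctor T (1 : ℤ)) (fun k hk hA =>
        t'.homZero_obj_shift_one rfl (hX _ (hgap k hk hA).2.2)) _ ?_)
      have h1 := t.δ.naturality (f X)
      have h2 := t'.δ.naturality (f X)
      have h3 := hθ.1 (X₁ X) ((hf X).supp hX)
      simp only [Functor.id_map, Functor.comp_map] at h1 h2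
      rw [Preadditive.sub_comp, sub_eq_zero]
      simp only [Functor.comp_map]
      rw [← h2, Category.assoc, ← Functor.map_comp, hη X hX, Functor.map_comp, ← h3,
        ← reassoc_of% h1]
    · refine sub_eq_zero.1 (cancel X Y hX hY _ ?_)
      obtain ⟨g₁, hg⟩ := (hf X).exists_extension (hf Y) g
      rw [Preadditive.sub_comp, sub_eq_zero, Category.assoc, hη Y hY, Category.assoc,
        ← Functor.map_comp, hg, Functor.map_comp, reassoc_of% (hη X hX), ← Functor.map_comp_assoc,
        hg, Functor.map_comp_assoc, hθ.2 _ _ ((hf X).supp hX) ((hf Y).supp hY) g₁]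
  · refine ⟨max N (b + d.toNat), fun θ₁ θ₂ h₁ h₂ X hX => ?_⟩
    have hA : ∀ k, A k → |k| ≤ (max N (b + d.toNat) : ℕ) := fun k hk =>
      (hb k hk).trans (by push_cast; omega)
    have hA' : ∀ k, pushSupp d p A k → |k| ≤ (max N (b + d.toNat) : ℕ) := by
      rintro k (⟨-, hk⟩ | ⟨-, hk⟩)
      · exact hA k hk
      · have := abs_le.1 (hb _ hk)
        rw [abs_le]; push_cast; omega
    have hN' : ∀ k : ℤ, |k| ≤ N → |k| ≤ (max N (b + d.toNat) : ℕ) := fun k hk =>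
      hk.trans (by push_cast; omega)
    have hX₁ := (hf X).supp hX
    have hθ := hN θ₁ θ₂ (h₁.mono fun _ h => h.mono hN') (h₂.mono fun _ h => h.mono hN') _ hX₁
    refine sub_eq_zero.1 (cancel X X hX hX _ ?_)
    rw [Preadditive.sub_comp, sub_eq_zero, ← h₁.2 _ _ (hX.mono hA) (hX₁.mono hA') (f X),
      ← h₂.2 _ _ (hX.mono hA) (hX₁.mono hA') (f X), hθ]

theorem fillable_of_gap [CalabiYau T d] (hE : IsSpherical d E) (hd : 2 ≤ d)
    (hpush : ∀ (p : ℤ) (X : T), ∃ (X₁ : T) (f : X ⟶ X₁), IsPush E d p f) (n : ℕ) :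
    ∀ (p : ℤ) (A : ℤ → Prop), (∃ b : ℕ, ∀ k, A k → |k| ≤ b) → (∀ k, A k → k ≤ p + n) →
      (∀ k ≤ p, A k → ∀ j, A j → k - 2 * d + 1 ≤ j → k - d + 1 < j) → Fillable t t' A := by
  induction n with
  | zero =>
    rintro p A ⟨b, hb⟩ hp hgap
    refine fillable_of_spaced t t' hE hd (fun k hk hk' => ?_) hb
    have h1 := hp _ hk'
    have := hgap _ (by simpa using h1) hk' k hk (by linarith)
    linarith
  | succ n ih =>
    have bound : ∀ (p : ℤ) (A : ℤ → Prop), (∃ b : ℕ, ∀ k, A k → |k| ≤ b) →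
        ∃ b : ℕ, ∀ k, pushSupp d p A k → |k| ≤ b := by
      rintro p A ⟨b, hb⟩
      refine ⟨b + d.toNat, ?_⟩
      rintro k (⟨-, hk⟩ | ⟨-, hk⟩)
      · exact (hb k hk).trans (by push_cast; omega)
      · have := abs_le.1 (hb _ hk)
        rw [abs_le]; push_cast; omega
    have gap : ∀ (p : ℤ) (A : ℤ → Prop),
        (∀ k ≤ p, A k → ∀ j, A j → k - 2 * d + 1 ≤ j → k - d + 1 < j) →
        ∀ k ≤ p, pushSupp d p A k → ∀ j, pushSupp d p A j → k - 2 * d + 1 ≤ j →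
          k - d + 1 < j := by
      rintro p A hgap k hk (⟨h1, -⟩ | ⟨h1, h2⟩) j (⟨h3, -⟩ | ⟨h3, h4⟩) hj
      · omega
      · omega
      · omega
      · have := hgap _ h1 h2 _ h4 (by linarith)
        linarith
    have pull : ∀ (p : ℤ) (A : ℤ → Prop), (∃ b : ℕ, ∀ k, A k → |k| ≤ b) →
        (∀ k ≤ p, A k → ∀ j, A j → k - 2 * d + 1 ≤ j → k - d + 1 < j) →
        Fillable t t' (pushSupp d p A) → Fillable t t' A := by
      rintro p A ⟨b, hb⟩ hgap h
      refine h.of_pushSupp t t' hd (hpush p) hb fun k hk hA => ⟨fun hj => ?_, fun hj => ?_,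
        fun hj => ?_⟩ <;> have := hgap k hk hA _ hj (by linarith) <;> linarith
    intro p A hb hp hgap
    refine pull p A hb hgap (pull p _ (bound p _ hb) (gap p _ hgap) (pull p _
      (bound p _ (bound p _ hb)) (gap p _ (gap p _ hgap)) (ih (p + 1) _
      (bound p _ (bound p _ (bound p _ hb))) ?_ ?_)))
    · rintro k (⟨-, ⟨-, ⟨-, h⟩ | ⟨h, -⟩⟩ | ⟨h, -⟩⟩ | ⟨h, -⟩)
      · have := hp _ h
        push_cast at this; linarith
      all_goals omega
    · intro k hk hkA j hj hkj
      rcases hk.lt_or_eq with hk | rfl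
      · exact gap p _ (gap p _ (gap p _ hgap)) k (by linarith) hkA j hj hkj
      · by_contra hj'
        rcases hj with ⟨h, -⟩ | ⟨h', ⟨h, -⟩ | ⟨h'', ⟨h, -⟩ | ⟨h, -⟩⟩⟩ <;> omega

theorem fillable_ball [CalabiYau T d] (hE : IsSpherical d E) (hd : 2 ≤ d)
    (hpush : ∀ (p : ℤ) (X : T), ∃ (X₁ : T) (f : X ⟶ X₁), IsPush E d p f) (n : ℕ) :
    Fillable t t' (fun k => |k| ≤ n) := by
  refine fillable_of_gap t t' hE hd hpush (2 * n + 1) (-n - 1) _ ⟨n, fun _ h => h⟩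
    (fun k hk => ?_) (fun k hk hk' => ?_)
  · have := (abs_le.1 hk).2
    push_cast; linarith
  · have := (abs_le.1 hk').1
    linarith

variable {t t'} in
theorem IsFill.eq_of_forall [CalabiYau T d] (hE : IsSpherical d E) (hd : 2 ≤ d)
    (hpush : ∀ (p : ℤ) (X : T), ∃ (X₁ : T) (f : X ⟶ X₁), IsPush E d p f)
    (hb : ∀ X : T, ∃ n : ℕ, Supp E (fun k => |k| ≤ n) X)
    {θ₁ θ₂ : ∀ X, t.Φ.obj X ⟶ t'.Φ.obj X} (h₁ : IsFill t t' (fun _ => True) θ₁)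
    (h₂ : IsFill t t' (fun _ => True) θ₂) (X : T) : θ₁ X = θ₂ X := by
  obtain ⟨n, hn⟩ := hb X
  obtain ⟨-, N, hN⟩ := fillable_ball t t' hE hd hpush n
  exact hN _ _ (h₁.mono fun _ _ => trivial) (h₂.mono fun _ _ => trivial) X hn

theorem exists_global_fill [CalabiYau T d] (hE : IsSpherical d E) (hd : 2 ≤ d)
    (hpush : ∀ (p : ℤ) (X : T), ∃ (X₁ : T) (f : X ⟶ X₁), IsPush E d p f)
    (hb : ∀ X : T, ∃ n : ℕ, Supp E (fun k => |k| ≤ n) X) :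
    ∃ θ, IsFill t t' (fun _ => True) θ := by
  choose n hn using hb
  choose hex N hN using fillable_ball t t' hE hd hpush
  choose θ hθ using hex
  have mono : ∀ (a b : ℕ) (X : T), a ≤ b → Supp E (fun k => |k| ≤ a) X →
      Supp E (fun k => |k| ≤ b) X := fun a b X hab h =>
    h.mono fun k hk => hk.trans (by exact_mod_cast hab)
  have agree : ∀ X, ∀ M, max (n X) (N (n X)) ≤ M →
      θ (max (n X) (N (n X))) X = θ M X := fun X M hM =>
    hN (n X) _ _ ((hθ _).mono fun Y hY => mono _ _ Y (le_max_right _ _) hY)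
      ((hθ M).mono fun Y hY => mono _ _ Y ((le_max_right _ _).trans hM) hY) X (hn X)
  refine ⟨fun X => θ (max (n X) (N (n X))) X, fun X _ => (hθ _).1 X (mono _ _ X
    (le_max_left _ _) (hn X)), fun X Y _ _ g => ?_⟩
  have hX := le_max_left (max (n X) (N (n X))) (max (n Y) (N (n Y)))
  have hY := le_max_right (max (n X) (N (n X))) (max (n Y) (N (n Y)))
  simp only [agree X _ hX, agree Y _ hY]
  exact (hθ _).2 X Y (mono _ _ X ((le_max_left _ _).trans hX) (hn X))
    (mono _ _ Y ((le_max_left _ _).trans hY) (hn Y)) g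

variable {t t'} in
theorem IsFill.comp {t'' : TwistTriangle E d} {S : T → Prop}
    {θ : ∀ X, t.Φ.obj X ⟶ t'.Φ.obj X} {η : ∀ X, t'.Φ.obj X ⟶ t''.Φ.obj X}
    (hθ : IsFill t t' S θ) (hη : IsFill t' t'' S η) : IsFill t t'' S fun X => θ X ≫ η X :=
  ⟨fun X hX => by rw [Functor.map_comp, ← Category.assoc, hθ.1 X hX, hη.1 X hX],
    fun X Y hX hY g => by
      rw [← Category.assoc, hθ.2 X Y hX hY, Category.assoc, hη.2 X Y hX hY, Category.assoc]⟩

theorem IsFill.id (S : T → Prop) : IsFill t t S fun _ => 𝟙 _ :=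
  ⟨fun X _ => by
    simp only [CategoryTheory.Functor.map_id]; exact Category.comp_id _, fun X Y _ _ g => by simp⟩

theorem nonempty_iso_of_push [CalabiYau T d] (hE : IsSpherical d E) (hd : 2 ≤ d)
    (hpush : ∀ (p : ℤ) (X : T), ∃ (X₁ : T) (f : X ⟶ X₁), IsPush E d p f)
    (hb : ∀ X : T, ∃ n : ℕ, Supp E (fun k => |k| ≤ n) X) : Nonempty (t.Φ ≅ t'.Φ) := by
  obtain ⟨θ, hθ⟩ := exists_global_fill t t' hE hd hpush hb
  obtain ⟨η, hη⟩ := exists_global_fill t' t hE hd hpush hb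
  exact ⟨NatIso.ofComponents (fun X => ⟨θ X, η X,
      (hθ.comp hη).eq_of_forall hE hd hpush hb (IsFill.id t _) X,
      (hη.comp hθ).eq_of_forall hE hd hpush hb (IsFill.id t' _) X⟩)
    fun g => hθ.2 _ _ trivial trivial g⟩

end Fill

section Brick

/-- A nonzero object all of whose nonzero endomorphisms are invertible. -/
def IsBrick (X : T) : Prop := 𝟙 X ≠ 0 ∧ ∀ f : X ⟶ X, f = 0 ∨ IsIso f

theorem IsBrick.map {X : T} (h : IsBrick X) (G : T ⥤ T) [G.IsEquivalence] :
    IsBrick (G.obj X) := by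
  refine ⟨fun h0 => h.1 (G.map_injective (by rw [G.map_id, h0, G.map_zero])), fun f => ?_⟩
  obtain ⟨g, rfl⟩ := G.map_surjective f
  rcases h.2 g with rfl | hg
  · exact Or.inl (G.map_zero _ _)
  · exact Or.inr inferInstance

theorem IsBrick.iso_of_factor {X Y : T} (hX : IsBrick X) (hY : IsBrick Y)
    (a : X ⟶ Y) (b : Y ⟶ X) (h : a ≫ b ≠ 0) : Nonempty (X ≅ Y) := by
  have h1 : IsIso (a ≫ b) := (hX.2 _).resolve_left h
  have h2 : IsIso (b ≫ a) := by
    refine (hY.2 _).resolve_left fun h0 => h ?_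
    have h3 : (a ≫ b) ≫ (a ≫ b) = 0 := by
      rw [Category.assoc, ← Category.assoc b, h0]; simp
    rw [← cancel_mono (a ≫ b), h3]; simp
  have : Mono a := mono_of_mono a b
  have : IsSplitEpi a := ⟨⟨⟨inv (b ≫ a) ≫ b, by simp⟩⟩⟩
  have : IsIso a := isIso_of_mono_of_isSplitEpi a
  exact ⟨asIso a⟩

theorem IsBrick.exists_iso_of_retract {X : T} (hX : IsBrick X) {m : ℕ} {Y : Fin m → T}
    (hY : ∀ p, IsBrick (Y p)) (a : X ⟶ ⨁ Y) (b : ⨁ Y ⟶ X) (h : a ≫ b = 𝟙 X) :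
    ∃ p, Nonempty (X ≅ Y p) ∧ a ≫ biproduct.π Y p ≠ 0 := by
  by_contra! hc
  apply hX.1
  rw [← h, ← Category.id_comp b, ← biproduct.total, Preadditive.sum_comp, Preadditive.comp_sum]
  refine Finset.sum_eq_zero fun p _ => ?_
  by_contra h0
  have h1 : (a ≫ biproduct.π Y p) ≫ biproduct.ι Y p ≫ b ≠ 0 := by simpa using h0
  exact h1 (by rw [hc p (hX.iso_of_factor (hY p) _ _ h1), zero_comp])

variable {d : ℤ} {E : T}

theorem IsSpherical.finrank_end (hE : IsSpherical d E) : finrank ℂ (E ⟶ E) = 1 := by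
  rw [← hE.1]
  exact (Linear.homCongr ℂ (Iso.refl E) ((shiftFunctorZero T ℤ).app E)).finrank_eq.symm

theorem IsSpherical.id_ne_zero (hE : IsSpherical d E) : 𝟙 E ≠ 0 := fun h => by
  have : Subsingleton (E ⟶ E) := ⟨fun f g => by
    rw [← Category.id_comp f, ← Category.id_comp g, h, zero_comp, zero_comp]⟩
  have := hE.finrank_end
  rw [finrank_zero_of_subsingleton] at this
  exact one_ne_zero this.symm

theorem IsSpherical.exists_smul_id (hE : IsSpherical d E) (f : E ⟶ E) :
    ∃ c : ℂ, c • 𝟙 E = f :=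
  (finrank_eq_one_iff_of_nonzero' _ hE.id_ne_zero).1 hE.finrank_end f

theorem IsSpherical.isBrick (hE : IsSpherical d E) : IsBrick E := by
  refine ⟨hE.id_ne_zero, fun f => ?_⟩
  obtain ⟨c, rfl⟩ := hE.exists_smul_id f
  by_cases hc : c = 0
  · exact Or.inl (by rw [hc, zero_smul])
  · refine Or.inr ⟨c⁻¹ • 𝟙 E, ?_, ?_⟩ <;> simp [smul_smul, hc]

end Brick

section Twist

variable {d : ℤ} {E : T}

/-- Morphisms `E⟦-n⟧ ⟶ X` identify with morphisms `E ⟶ X⟦n⟧`. -/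
noncomputable def shiftTranspose (E X : T) (n : ℤ) : (E⟦-n⟧ ⟶ X) ≃ (E ⟶ X⟦n⟧) :=
  (shiftEquiv' T (-n) n (neg_add_cancel _)).toAdjunction.homEquiv E X

theorem shiftTranspose_comp {X Y : T} {n : ℤ} (c : E⟦-n⟧ ⟶ X) (f : X ⟶ Y) :
    shiftTranspose E Y n (c ≫ f) = shiftTranspose E X n c ≫ f⟦n⟧' :=
  Adjunction.homEquiv_naturality_right _ _ _

theorem shiftTranspose_shift_comp {X E' : T} {n : ℤ} (z : E' ⟶ E) (c : E⟦-n⟧ ⟶ X) :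
    shiftTranspose E' X n (z⟦-n⟧' ≫ c) = z ≫ shiftTranspose E X n c :=
  Adjunction.homEquiv_naturality_left _ _ _

theorem shiftTranspose_add {X : T} {n : ℤ} (a b : E⟦-n⟧ ⟶ X) :
    shiftTranspose E X n (a + b) = shiftTranspose E X n a + shiftTranspose E X n b := by
  have h : ∀ c : E⟦-n⟧ ⟶ X, shiftTranspose E X n c =
      shiftTranspose E (E⟦-n⟧) n (𝟙 _) ≫ c⟦n⟧' := fun c => by
    rw [← shiftTranspose_comp, Category.id_comp]
  rw [h, h a, h b, Functor.map_add, Preadditive.comp_add]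

theorem shiftTranspose_zero (X : T) (n : ℤ) : shiftTranspose E X n 0 = 0 := by
  simpa using shiftTranspose_add (E := E) (X := X) (n := n) 0 0

theorem shiftTranspose_sum {X : T} {n : ℤ} {ι : Type*} (s : Finset ι) (a : ι → (E⟦-n⟧ ⟶ X)) :
    shiftTranspose E X n (∑ i ∈ s, a i) = ∑ i ∈ s, shiftTranspose E X n (a i) :=
  map_sum (AddMonoidHom.mk ⟨shiftTranspose E X n, shiftTranspose_zero X n⟩ shiftTranspose_add) a s

namespace SphericalTwist

variable (t : SphericalTwist E)

/-- The component of the evaluation map at a basis vector. -/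
noncomputable def component (X : T) (q : Fin (t.m X)) : E⟦-(t.deg X q)⟧ ⟶ X :=
  (shiftTranspose E X _).symm (t.bas X _ ⟨q, rfl⟩)

theorem shiftTranspose_component (X : T) (q : Fin (t.m X)) :
    shiftTranspose E X _ (t.component X q) = t.bas X _ ⟨q, rfl⟩ :=
  Equiv.apply_symm_apply _ _

theorem component_ne_zero (X : T) (q : Fin (t.m X)) : t.component X q ≠ 0 := fun h =>
  (t.bas X _).ne_zero ⟨q, rfl⟩ (by
    rw [← t.shiftTranspose_component, h, shiftTranspose_zero])

theorem comp_eq_zero_of_component {X Y : T} (f : X ⟶ Y) {k : ℤ}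
    (hf : ∀ q, -(t.deg X q) = k → t.component X q ≫ f = 0) (c : E⟦k⟧ ⟶ X) : c ≫ f = 0 := by
  obtain ⟨n, rfl⟩ : ∃ n : ℤ, k = -n := ⟨-k, by ring⟩
  refine (shiftTranspose E Y n).injective ?_
  rw [shiftTranspose_comp, shiftTranspose_zero]
  have h : Linear.rightComp ℂ E (f⟦n⟧') = 0 := by
    refine (t.bas X n).ext ?_
    rintro ⟨q, rfl⟩
    rw [Linear.rightComp_apply, LinearMap.zero_apply, ← t.shiftTranspose_component,
      ← shiftTranspose_comp, hf q rfl, shiftTranspose_zero]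
  exact LinearMap.congr_fun h _

theorem exists_smul_bas (hE : IsSpherical d E) {X : T} {n : ℤ} (q : Fin (t.m X))
    (h : t.deg X q = n) (z : E⟦-n⟧ ⟶ E⟦-(t.deg X q)⟧) :
    ∃ c : ℂ, shiftTranspose E X n (z ≫ t.component X q) = c • t.bas X n ⟨q, h⟩ ∧
      (c = 0 → z = 0) := by
  subst h
  obtain ⟨z, rfl⟩ := (shiftFunctor T (-(t.deg X q))).map_surjective z
  obtain ⟨c, rfl⟩ := hE.exists_smul_id z
  refine ⟨c, ?_, ?_⟩
  · rw [shiftTranspose_shift_comp, t.shiftTranspose_component, Linear.smul_comp, Category.id_comp]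
  · rintro rfl
    rw [zero_smul, Functor.map_zero]

theorem eq_zero_of_comp_desc (hE : IsSpherical d E) {X : T} {m : ℕ} {σ : Fin m → Fin (t.m X)}
    (hσ : Function.Injective σ) {k : ℤ} (hk : ∀ i, -(t.deg X (σ i)) ≠ k + d)
    (z : E⟦k⟧ ⟶ ⨁ fun i => E⟦-(t.deg X (σ i))⟧)
    (hz : z ≫ biproduct.desc (fun i => t.component X (σ i)) = 0) : z = 0 := by
  obtain ⟨n, rfl⟩ : ∃ n : ℤ, k = -n := ⟨-k, by ring⟩
  have hsum : ∑ i, shiftTranspose E X n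
      ((z ≫ biproduct.π _ i) ≫ t.component X (σ i)) = 0 := by
    rw [← shiftTranspose_sum, ← shiftTranspose_zero, ← hz, biproduct.desc_eq,
      Preadditive.comp_sum]
    simp
  have hne : ∀ i, t.deg X (σ i) ≠ n → z ≫ biproduct.π _ i = 0 := fun i hi =>
    hE.homZero (fun h => hi (by linarith)) (fun h => hk i (by linarith)) _
  refine biproduct.hom_ext _ _ fun i => ?_
  rw [zero_comp]
  by_cases hi : t.deg X (σ i) = n
  · obtain ⟨c, hc, hc0⟩ := t.exists_smul_bas hE (σ i) hi (z ≫ biproduct.π _ i)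
    apply hc0
    have h1 := congrArg ((t.bas X n).coord ⟨σ i, hi⟩) hsum
    rw [map_zero, map_sum, Finset.sum_eq_single i, hc] at h1
    · simpa using h1
    · intro j _ hj
      by_cases hj' : t.deg X (σ j) = n
      · obtain ⟨c', hc', -⟩ := t.exists_smul_bas hE (σ j) hj' (z ≫ biproduct.π _ j)
        rw [hc', map_smul, Basis.coord_apply, Basis.repr_self, Finsupp.single_eq_of_ne,
          smul_zero]
        exact fun h => hj (hσ (Subtype.ext_iff.1 h).symm)
      · rw [hne j hj', zero_comp, shiftTranspose_zero, map_zero]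
    · exact fun h => absurd (Finset.mem_univ i) h
  · exact hne i hi

theorem exists_isPush (t : SphericalTwist E) (hE : IsSpherical d E) (p : ℤ) (X : T) :
    ∃ (X₁ : T) (f : X ⟶ X₁), IsPush E d p f := by
  let e := Fintype.equivFin {q : Fin (t.m X) // -(t.deg X q) ≤ p}
  let σ : Fin _ → Fin (t.m X) := fun i => (e.symm i).1
  have hσ : Function.Injective σ := Subtype.val_injective.comp e.symm.injective
  have hσp : ∀ i, -(t.deg X (σ i)) ≤ p := fun i => (e.symm i).2
  let w : ⨁ (fun i => E⟦-(t.deg X (σ i))⟧) ⟶ X := biproduct.desc fun i => t.component X (σ i)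
  obtain ⟨X₁, f, g, hT⟩ := distinguished_cocone_triangle w
  have hwf : w ≫ f = 0 := comp_distTriang_mor_zero₁₂ _ hT
  have hgw : g ≫ w⟦(1 : ℤ)⟧' = 0 := comp_distTriang_mor_zero₃₁ _ hT
  have kill : ∀ k ≤ p, ∀ c : E⟦k⟧ ⟶ X, c ≫ f = 0 := fun k hk =>
    t.comp_eq_zero_of_component f fun q hq => by
      have h1 : σ (e ⟨q, hq.trans_le hk⟩) = q := by simp [σ]
      have h2 : ∀ i, t.component X (σ i) ≫ f = 0 := fun i => by
        rw [← biproduct.ι_desc (fun i => t.component X (σ i)) i, Category.assoc, hwf, comp_zero]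
      exact h1 ▸ h2 (e ⟨q, hq.trans_le hk⟩)
  refine ⟨X₁, f, ⟨_, _, w, g, hT, fun i => ⟨hσp i, fun h => t.component_ne_zero X _ (h _)⟩⟩,
    kill, fun k hk => ?_⟩
  by_contra! hc
  refine hk fun c => ?_
  have hz : c ≫ g = 0 := by
    let s := shiftShiftIso E (k - 1) 1 k (by ring)
    obtain ⟨z, hz⟩ := (shiftFunctor T (1 : ℤ)).map_surjective (s.hom ≫ c ≫ g)
    have hz0 : z = 0 := by
      refine t.eq_zero_of_comp_desc hE hσ (fun i hi => ?_) z
        ((shiftFunctor T (1 : ℤ)).map_injective ?_)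
      · have h1 : -(t.deg X (σ i)) = k + d - 1 := by linarith
        exact t.component_ne_zero X (σ i) ((h1 ▸ hc.2 (h1 ▸ hσp i) :
          HomZero (E⟦-(t.deg X (σ i))⟧) X) _)
      · rw [Functor.map_comp, hz, Functor.map_zero, Category.assoc, Category.assoc, hgw,
          comp_zero, comp_zero]
    rw [← cancel_epi s.hom, ← hz, hz0, comp_zero, Functor.map_zero]
  obtain ⟨x, hx⟩ := Triangle.coyoneda_exact₃ _ hT c hz
  refine hx.trans ?_
  by_cases hkp : k ≤ p
  · exact kill k hkp x
  · exact (congrArg (· ≫ f) (hc.1 (not_le.1 hkp) x)).trans zero_comp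

attribute [instance] SphericalTwist.equiv

/-- The twist commutes with shifts on objects. -/
noncomputable def shiftIso (X : T) (k : ℤ) : t.Φ.obj (X⟦k⟧) ≅ (t.Φ.obj X)⟦k⟧ :=
  (t.commShift.commShiftIso k).app X

theorem exists_iso_of_connecting_eq_zero (hE : IsSpherical d E) {X : T} (hX : IsBrick X)
    (h : t.δ.app X = 0) : ∃ k : ℤ, Nonempty (X ≅ E⟦k⟧) := by
  obtain ⟨b : X ⟶ t.Ψ.obj X, hb⟩ := Triangle.coyoneda_exact₃ _ (t.dist X) (𝟙 X)
    ((congrArg (𝟙 X ≫ ·) h).trans comp_zero)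
  obtain ⟨q, hq, -⟩ := hX.exists_iso_of_retract (fun q => hE.isBrick.map (shiftFunctor T _))
    (b ≫ (t.decomp X).hom) ((t.decomp X).inv ≫ t.ε.app X) (by
      rw [Category.assoc, Iso.hom_inv_id_assoc]; exact hb.symm)
  exact ⟨_, hq⟩

theorem component_eq (X : T) (q : Fin (t.m X)) :
    biproduct.ι (fun q : Fin (t.m X) => E⟦-(t.deg X q)⟧) q ≫ (t.decomp X).inv ≫ t.ε.app X =
      t.component X q :=
  t.eval X q

theorem deg_self (hE : IsSpherical d E) (q : Fin (t.m E)) : t.deg E q = 0 ∨ t.deg E q = d := by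
  by_contra! h
  exact (t.bas E _).ne_zero ⟨q, rfl⟩ (hE.2.2 _ h.1 h.2 _)

theorem isIso_component_self (hE : IsSpherical d E) {q : Fin (t.m E)} (hq : t.deg E q = 0) :
    IsIso (t.component E q) := by
  let e : E⟦-(t.deg E q)⟧ ≅ E := eqToIso (by rw [hq, neg_zero]) ≪≫ (shiftFunctorZero T ℤ).app E
  have h : IsIso (e.inv ≫ t.component E q) := (hE.isBrick.2 _).resolve_left fun h =>
    t.component_ne_zero E q (by rw [← cancel_epi e.inv, h, comp_zero])
  exact IsIso.of_isIso_comp_left e.inv _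

theorem existsUnique_deg_self_eq_zero (hE : IsSpherical d E) :
    ∃ q, t.deg E q = 0 ∧ ∀ q', t.deg E q' = 0 → q' = q := by
  have h := finrank_eq_card_basis (t.bas E 0)
  rw [hE.1] at h
  obtain ⟨⟨q, hq⟩, h⟩ := Fintype.card_eq_one_iff.1 h.symm
  exact ⟨q, hq, fun q' hq' => congrArg Subtype.val (h ⟨q', hq'⟩)⟩

theorem connecting_self (hE : IsSpherical d E) : t.δ.app E = 0 := by
  obtain ⟨q, hq, -⟩ := t.existsUnique_deg_self_eq_zero hE
  have := t.isIso_component_self hE hq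
  have h0 : t.ε.app E ≫ t.δ.app E = 0 := comp_distTriang_mor_zero₂₃ _ (t.dist E)
  have h1 : t.component E q ≫ t.δ.app E = 0 := by
    rw [← t.component_eq, Category.assoc, Category.assoc]
    exact (congrArg (fun x => _ ≫ _ ≫ x) h0).trans (by rw [comp_zero, comp_zero])
  rw [← cancel_epi (t.component E q), h1, comp_zero]

/-- A spherical twist shifts its own spherical object. -/
theorem nonempty_obj_self_iso (hE : IsSpherical d E) (hd : 2 ≤ d) :
    Nonempty (t.Φ.obj E ≅ E⟦-d⟧) := by
  obtain ⟨r, hr⟩ := exists_factor_of_connecting (t.dist E) (𝟙 (t.Φ.obj E))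
    ((congrArg (· ≫ _) (t.connecting_self hE)).trans zero_comp)
  obtain ⟨a, ha⟩ : ∃ a, a = t.α.app E ≫ (t.decomp E).hom := ⟨_, rfl⟩
  obtain ⟨q, ⟨i⟩, hq⟩ := (hE.isBrick.map t.Φ).exists_iso_of_retract
    (fun q => hE.isBrick.map (shiftFunctor T _)) a ((t.decomp E).inv ≫ r) (by
      rw [ha, Category.assoc, Iso.hom_inv_id_assoc, ← hr])
  rcases t.deg_self hE q with h | h
  · exfalso
    have hsum : a ≫ (t.decomp E).inv ≫ t.ε.app E = 0 := by
      rw [ha, Category.assoc, Iso.hom_inv_id_assoc]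
      exact comp_distTriang_mor_zero₁₂ _ (t.dist E)
    rw [← Category.id_comp ((t.decomp E).inv ≫ _), ← biproduct.total, Preadditive.sum_comp,
      Preadditive.comp_sum] at hsum
    simp only [Category.assoc, t.component_eq] at hsum
    rw [Finset.sum_eq_single q] at hsum
    · have := t.isIso_component_self hE h
      rw [← Category.assoc] at hsum
      exact hq (by rw [← cancel_mono (t.component E q), hsum, zero_comp])
    · intro q' _ hq'
      obtain ⟨q₀, -, h₀⟩ := t.existsUnique_deg_self_eq_zero hE
      have h' : t.deg E q' = d := (t.deg_self hE q').resolve_left fun h'' =>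
        hq' ((h₀ _ h'').trans (h₀ _ h).symm)
      have hz : HomZero (t.Φ.obj E) (E⟦-(t.deg E q')⟧) :=
        (hE.homZero (by linarith) (by linarith)).of_iso_left i
      rw [← Category.assoc, hz (a ≫ _), zero_comp]
    · exact fun h => absurd (Finset.mem_univ q) h
  · exact ⟨i ≪≫ eqToIso (by rw [h])⟩

/-- The twist of `X`, if it is a shift `X⟦k⟧` with `X⟦k + 1⟧` receiving no maps from `X`,
has zero connecting morphism. -/
theorem connecting_eq_zero {X : T} {k : ℤ} (i : t.Φ.obj X ≅ X⟦k⟧) (h : HomZero X (X⟦k + 1⟧)) :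
    t.δ.app X = 0 :=
  h.of_iso_right ((shiftFunctor T (1 : ℤ)).mapIso i ≪≫ shiftShiftIso _ _ _ _ rfl) (t.δ.app X)

/-- A spherical twist along `E`, seen as a twist triangle along `E'` when `E` is a shift
of `E'`. -/
noncomputable def toTwistTriangle (t : SphericalTwist E) (hE : IsSpherical d E) (hd : 2 ≤ d)
    {E' : T} {j : ℤ} (i : E ≅ E'⟦j⟧) : TwistTriangle E' d where
  Φ := t.Φ
  equiv := t.equiv
  Ψ := t.Ψ
  α := t.α
  ε := t.ε
  δ := t.δ
  dist := t.dist
  decomp X := ⟨t.m X, fun q => j + -(t.deg X q), ⟨t.decomp X ≪≫ biproduct.mapIso fun q =>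
    (shiftFunctor T _).mapIso i ≪≫ shiftShiftIso _ _ _ _ rfl⟩⟩
  act k := by
    obtain ⟨e⟩ := t.nonempty_obj_self_iso hE hd
    let s (n : ℤ) : E'⟦n⟧ ≅ E⟦n - j⟧ :=
      (shiftShiftIso E' j (n - j) n (by ring)).symm ≪≫ (shiftFunctor T (n - j)).mapIso i.symm
    exact ⟨t.Φ.mapIso (s k) ≪≫ t.shiftIso E (k - j) ≪≫ (shiftFunctor T (k - j)).mapIso e ≪≫
      shiftShiftIso E (-d) (k - j) (k - d - j) (by ring) ≪≫ (s (k - d)).symm⟩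

end SphericalTwist

theorem exists_supp_ball [HomFiniteBounded T] (E X : T) :
    ∃ n : ℕ, Supp E (fun k => |k| ≤ n) X := by
  obtain ⟨n, hn⟩ := HomFiniteBounded.bounded E X
  refine ⟨n, fun k hk => ?_⟩
  have h : HomZero E (X⟦-k⟧) := hn (-k) (by rw [abs_neg]; exact not_le.1 hk)
  rw [← homZero_shift_left (a := k) (b := 0) (by ring)] at h
  exact h.of_iso_right ((shiftFunctorZero T ℤ).app X).symm

/-- Spherical twists along objects in the same orbit under shifts are isomorphic. -/
theorem SphericalTwist.nonempty_iso [HomFiniteBounded T] [CalabiYau T d] (hd : 2 ≤ d) {F : T}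
    (hE : IsSpherical d E) (hF : IsSpherical d F) (tE : SphericalTwist E) (tF : SphericalTwist F)
    {j : ℤ} (i : F ≅ E⟦j⟧) : Nonempty (tE.Φ ≅ tF.Φ) :=
  nonempty_iso_of_push (tE.toTwistTriangle hE hd ((shiftFunctorZero T ℤ).app E).symm)
    (tF.toTwistTriangle hF hd i) hE hd (tE.exists_isPush hE) (exists_supp_ball E)

/-- If commuting spherical twists have spherical objects that are not orthogonal, then these
objects differ by a shift. -/
theorem SphericalTwist.exists_iso_shift_of_comm [HomFiniteBounded T] (hd : 2 ≤ d) {F : T}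
    (hE : IsSpherical d E) (hF : IsSpherical d F) (tE : SphericalTwist E) (tF : SphericalTwist F)
    (hcomm : tF.Φ ⋙ tE.Φ ≅ tE.Φ ⋙ tF.Φ) {i : ℤ} (hi : ¬ HomZero E (F⟦i⟧)) :
    ∃ j : ℤ, Nonempty (F ≅ E⟦j⟧) := by
  obtain ⟨eE⟩ := tE.nonempty_obj_self_iso hE hd
  obtain ⟨eF⟩ := tF.nonempty_obj_self_iso hF hd
  have hFF : HomZero F (F⟦-d + 1⟧) := hF.2.2 _ (by linarith) (by linarith)
  obtain ⟨k, ⟨e⟩⟩ : ∃ k : ℤ, Nonempty (tE.Φ.obj F ≅ F⟦k⟧) :=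
    tF.exists_iso_of_connecting_eq_zero hF (hF.isBrick.map tE.Φ)
      (tF.connecting_eq_zero ((hcomm.app F).symm ≪≫ tE.Φ.mapIso eF ≪≫ tE.shiftIso F (-d))
        ((hFF.map tE.Φ).of_iso_right (tE.shiftIso F _).symm))
  have step : ∀ a : ℤ, HomZero E (F⟦a + (k + d)⟧) → HomZero E (F⟦a⟧) := fun a h => by
    rw [← homZero_shift_left (a := -d) (b := k + a) (by ring)] at h
    exact HomZero.of_map tE.Φ ((h.of_iso_left eE).of_iso_right
      (tE.shiftIso F a ≪≫ (shiftFunctor T a).mapIso e ≪≫ shiftShiftIso F k a _ rfl))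
  have hk : k = -d := by
    by_contra hk
    have hn : ∀ n : ℕ, ¬ HomZero E (F⟦i + n * (k + d)⟧) := fun n => by
      induction n with
      | zero => simpa using hi
      | succ n ih =>
        refine fun h => ih (step _ ?_)
        convert h using 2
        push_cast; ring_nf
    obtain ⟨N, hN⟩ := HomFiniteBounded.bounded E F
    refine hn (N + i.natAbs + 1) (hN _ ?_)
    have h1 : 1 ≤ |k + d| := Int.one_le_abs fun h => hk (by linarith)
    have h2 : ((N + i.natAbs + 1 : ℕ) : ℤ) ≤ |((N + i.natAbs + 1 : ℕ) : ℤ) * (k + d)| := by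
      rw [abs_mul, Nat.abs_cast]
      exact le_mul_of_one_le_right (Nat.cast_nonneg _) h1
    have h3 := abs_sub_abs_le_abs_add (((N + i.natAbs + 1 : ℕ) : ℤ) * (k + d)) i
    rw [add_comm _ i] at h3
    refine lt_of_lt_of_le ?_ h3
    push_cast [Int.natCast_natAbs] at h2 ⊢
    linarith
  subst hk
  exact tE.exists_iso_of_connecting_eq_zero hE hF.isBrick (tE.connecting_eq_zero e hFF)

end Twist

/-- Let `X` be a smooth complex projective Calabi-Yau variety of
dimension `d ≥ 2` and let `E` and `F` be spherical objects of `D(X)` such that the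
spherical twists `Φ_E` and `Φ_F` are not isomorphic as functors.  If
`Φ_E ∘ Φ_F ≅ Φ_F ∘ Φ_E`, then `Hom(E, F[i]) = 0` for every integer `i`,
i.e. `F ∈ E^⊥`. -/
theorem commuting_spherical_twists_are_orthogonal
    [HomFiniteBounded T] (d : ℕ) (hd : 2 ≤ d) [CalabiYau T (d : ℤ)]
    {E F : T} (hE : IsSpherical (d : ℤ) E) (hF : IsSpherical (d : ℤ) F)
    (tE : SphericalTwist E) (tF : SphericalTwist F)
    (hne : ¬ Nonempty (tE.Φ ≅ tF.Φ))
    (hcomm : Nonempty (tF.Φ ⋙ tE.Φ ≅ tE.Φ ⋙ tF.Φ)) :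
    ∀ (i : ℤ) (f : E ⟶ F⟦i⟧), f = 0 := by
  intro i
  by_contra hi
  have hd' : (2 : ℤ) ≤ d := by exact_mod_cast hd
  obtain ⟨e⟩ := hcomm
  obtain ⟨j, ⟨e⟩⟩ := tE.exists_iso_shift_of_comm hd' hE hF tF e hi
  exact hne (SphericalTwist.nonempty_iso hd' hE hF tE tF e)

end SphericalPaper
end

section
/- Let X be a smooth complex projective Calabi-Yau variety of dimension d ≥ 2 and let E be a spherical object of D(X). Then for any object G of D(X), Φ_E(G) ≅ G[−d] if and only if G lies in ⟨E⟩, the smallest strictly full triangulated subcategory of D(X) containing E. -/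
/-!
This file formalizes a statement from "Commuting reflection functors and
orthogonal spherical objects".  Mathlib does not have bounded derived categories
of coherent sheaves on smooth projective varieties, so the geometric setting is
axiomatized: `T` plays the role of the bounded derived category `D(X)` of a
smooth complex projective variety `X` — a ℂ-linear triangulated category with
finite-dimensional, bounded graded Hom's — and the Calabi-Yau condition is
expressed by Serre duality in the form of a perfect trace pairing
`Hom(A,B) × Hom(B,A⟦d⟧) → ℂ`.
-/

open CategoryTheory Limits Pretriangulated Module

universe v u

namespace SphericalPaper

variable (T : Type u) [Category.{v} T] [Preadditive T] [Linear ℂ T]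
  [HasZeroObject T] [HasShift T ℤ] [∀ n : ℤ, (shiftFunctor T n).Additive]
  [Pretriangulated T] [HasFiniteBiproducts T]

variable {T}

/-- Membership in `⟨E⟩`, the smallest strictly full triangulated subcategory of
`T` containing `E`: the closure of `{E}` under isomorphisms, shifts and
extensions (cones) in distinguished triangles. -/
inductive Generates (E : T) : T → Prop
  | self : Generates E E
  | of_iso {G G' : T} : (G ≅ G') → Generates E G → Generates E G'
  | shift (G : T) (n : ℤ) : Generates E G → Generates E (G⟦n⟧)
  | ext (Tr : Triangle T) : (Tr ∈ distTriang T) → Generates E Tr.obj₁ →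
      Generates E Tr.obj₃ → Generates E Tr.obj₂

set_option linter.unusedSectionVars false

/-- `A` is isomorphic to `E⟦k⟧`. -/
def IsShift (E : T) (k : ℤ) (A : T) : Prop := Nonempty (A ≅ E⟦k⟧)

lemma IsShift.of_iso {E A B : T} {k : ℤ} (h : IsShift E k A) (e : B ≅ A) : IsShift E k B :=
  h.map fun a => e ≪≫ a

lemma IsShift.iso {E A B : T} {k : ℤ} (hA : IsShift E k A) (hB : IsShift E k B) :
    Nonempty (A ≅ B) :=
  ⟨hA.some ≪≫ hB.some.symm⟩

lemma isShift_shift (E : T) (k : ℤ) : IsShift E k (E⟦k⟧) := ⟨Iso.refl _⟩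

lemma isShift_zero (E : T) : IsShift E 0 E := ⟨((shiftFunctorZero T ℤ).app E).symm⟩

lemma IsShift.shift {E A : T} {k : ℤ} (h : IsShift E k A) (n m : ℤ) (hm : k + n = m) :
    IsShift E m (A⟦n⟧) :=
  ⟨(shiftFunctor T n).mapIso h.some ≪≫ ((shiftFunctorAdd' T k n m hm).app E).symm⟩

namespace IsSpherical

variable {d : ℤ} {E A B : T}

lemma exists_smul_eq_of_source (hE : IsSpherical d E) (c : ℤ) {f : E ⟶ E⟦c⟧} (hf : f ≠ 0)
    (g : E ⟶ E⟦c⟧) : ∃ l : ℂ, l • f = g := by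
  by_cases h0 : c = 0
  · subst h0
    exact (finrank_eq_one_iff_of_nonzero' f hf).1 hE.1 g
  by_cases hc : c = d
  · subst hc
    exact (finrank_eq_one_iff_of_nonzero' f hf).1 hE.2.1 g
  · exact absurd (hE.2.2 c h0 hc f) hf

lemma isIso_end (hE : IsSpherical d E) {f : E ⟶ E} (hf : f ≠ 0) : IsIso f := by
  let e : E ≅ E⟦(0 : ℤ)⟧ := (isShift_zero E).some
  have he : e.hom ≠ 0 := fun h => hf (by
    rw [← Category.comp_id f, ← e.hom_inv_id, h, zero_comp, comp_zero])
  obtain ⟨l, hl⟩ := hE.exists_smul_eq_of_source 0 he (f ≫ e.hom)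
  have hf' : f = l • 𝟙 E := by
    rw [← cancel_mono e.hom, ← hl, Linear.smul_comp, Category.id_comp]
  have hl0 : l ≠ 0 := by
    rintro rfl
    exact hf (by rw [hf', zero_smul])
  exact ⟨l⁻¹ • 𝟙 E, by simp [hf', hl0, smul_smul], by simp [hf', hl0, smul_smul]⟩

lemma not_isZero (hE : IsSpherical d E) : ¬ IsZero E := by
  intro h
  have := hE.1
  have : Subsingleton (E ⟶ E⟦(0 : ℤ)⟧) := ⟨fun f g => h.eq_of_src f g⟩
  simp [Module.finrank_zero_of_subsingleton] at *

/-- Translation of a morphism between shifts of `E` to one with source `E`. -/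
lemma exists_translation {a b : ℤ} (hA : IsShift E a A) (hB : IsShift E b B) :
    Nonempty ((A⟦-a⟧ ≅ E) × (B⟦-a⟧ ≅ E⟦b - a⟧)) :=
  ⟨(hA.shift (-a) 0 (by lia)).some ≪≫ (isShift_zero E).some.symm,
    (hB.shift (-a) (b - a) (by lia)).some⟩

lemma eq_zero_of_isShift (hE : IsSpherical d E) {a b : ℤ} (hA : IsShift E a A)
    (hB : IsShift E b B) (h0 : b ≠ a) (hd : b ≠ a + d) (f : A ⟶ B) : f = 0 := by
  obtain ⟨eA, eB⟩ := exists_translation hA hB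
  have h := hE.2.2 (b - a) (by lia) (by lia) (eA.inv ≫ f⟦-a⟧' ≫ eB.hom)
  rw [Preadditive.IsIso.comp_left_eq_zero, Preadditive.IsIso.comp_right_eq_zero] at h
  exact (shiftFunctor T (-a)).map_injective (by rw [h, Functor.map_zero])

lemma isIso_end_of_isShift (hE : IsSpherical d E) {a : ℤ} (hA : IsShift E a A) {f : A ⟶ A}
    (hf : f ≠ 0) : IsIso f := by
  obtain ⟨eA, -⟩ := exists_translation hA hA
  have h : IsIso (eA.inv ≫ f⟦-a⟧' ≫ eA.hom) := hE.isIso_end (fun h => hf (by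
    rw [Preadditive.IsIso.comp_left_eq_zero, Preadditive.IsIso.comp_right_eq_zero] at h
    exact (shiftFunctor T (-a)).map_injective (by rw [h, Functor.map_zero])))
  have h' : IsIso (f⟦-a⟧') := by
    have : f⟦-a⟧' = eA.hom ≫ (eA.inv ≫ f⟦-a⟧' ≫ eA.hom) ≫ eA.inv := by simp
    rw [this]
    infer_instance
  exact isIso_of_reflects_iso f (shiftFunctor T (-a))

lemma isIso_of_isShift (hE : IsSpherical d E) {a : ℤ} (hA : IsShift E a A) (hB : IsShift E a B)
    {f : A ⟶ B} (hf : f ≠ 0) : IsIso f := by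
  obtain ⟨e⟩ := hA.iso hB
  have h : IsIso (f ≫ e.inv) := hE.isIso_end_of_isShift hA (fun h => hf (by
    rwa [Preadditive.IsIso.comp_right_eq_zero] at h))
  have : f = (f ≫ e.inv) ≫ e.hom := by simp
  rw [this]
  infer_instance

lemma exists_end_eq_smul [HomFiniteBounded T] (hE : IsSpherical d E) {a : ℤ}
    (hA : IsShift E a A) (f : A ⟶ A) : ∃ l : ℂ, f = l • 𝟙 A := by
  have : FiniteDimensional ℂ (A ⟶ A) := HomFiniteBounded.finite A A
  by_cases hf : f = 0
  · exact ⟨0, by rw [hf, zero_smul]⟩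
  have : Nontrivial (A ⟶ A) := ⟨f, 0, hf⟩
  obtain ⟨l, hl⟩ := Module.End.exists_eigenvalue (Linear.rightComp ℂ A f)
  obtain ⟨x, hx, hx0⟩ := hl.exists_hasEigenvector
  have := hE.isIso_end_of_isShift hA hx0
  refine ⟨l, ?_⟩
  rw [← cancel_epi x]
  simpa [Module.End.mem_eigenspace_iff] using hx

lemma exists_smul_eq [HomFiniteBounded T] (hE : IsSpherical d E) {a b : ℤ}
    (hA : IsShift E a A) (hB : IsShift E b B) {f : A ⟶ B} (hf : f ≠ 0) (g : A ⟶ B) :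
    ∃ l : ℂ, g = l • f := by
  obtain ⟨eA, eB⟩ := exists_translation hA hB
  obtain ⟨l, hl⟩ := hE.exists_smul_eq_of_source (b - a)
    (f := eA.inv ≫ f⟦-a⟧' ≫ eB.hom) (fun h => hf (by
      rw [Preadditive.IsIso.comp_left_eq_zero, Preadditive.IsIso.comp_right_eq_zero] at h
      exact (shiftFunctor T (-a)).map_injective (by rw [h, Functor.map_zero])))
    (eA.inv ≫ g⟦-a⟧' ≫ eB.hom)
  have h : (l • 𝟙 (A⟦-a⟧)) ≫ f⟦-a⟧' = g⟦-a⟧' := by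
    rw [← cancel_epi eA.inv, ← cancel_mono eB.hom]
    simpa using hl
  obtain ⟨m, hm⟩ := hE.exists_end_eq_smul hA ((shiftFunctor T (-a)).preimage (l • 𝟙 (A⟦-a⟧)))
  refine ⟨m, (shiftFunctor T (-a)).map_injective ?_⟩
  rw [← h, ← Category.id_comp f, ← Linear.smul_comp, ← hm]
  simp

end IsSpherical

/-- Every morphism to `W` from a shift `E⟦k⟧` vanishes. -/
def NoHom (E : T) (k : ℤ) (W : T) : Prop := ∀ ⦃A : T⦄, IsShift E k A → ∀ f : A ⟶ W, f = 0

section Exactness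

variable {X Y Z W : T} {f : X ⟶ Y} {g : Y ⟶ Z} {h : Z ⟶ X⟦(1 : ℤ)⟧}

lemma exists_eq_mor₂_comp (hT : Triangle.mk f g h ∈ distTriang T) 
    {u : Y ⟶ W} (hu : f ≫ u = 0) : ∃ v : Z ⟶ W, u = g ≫ v :=
  Triangle.yoneda_exact₂ _ hT u hu

lemma exists_eq_comp_mor₁ (hT : Triangle.mk f g h ∈ distTriang T) 
    {u : W ⟶ Y} (hu : u ≫ g = 0) : ∃ v : W ⟶ X, u = v ≫ f :=
  Triangle.coyoneda_exact₂ _ hT u hu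

lemma exists_eq_comp_mor₂ (hT : Triangle.mk f g h ∈ distTriang T) 
    {u : W ⟶ Z} (hu : u ≫ h = 0) : ∃ v : W ⟶ Y, u = v ≫ g :=
  Triangle.coyoneda_exact₃ _ hT u hu

/-- Extension of a morphism along the first morphism of a distinguished triangle. -/
lemma exists_eq_mor₁_comp (hT : Triangle.mk f g h ∈ distTriang T) 
    {u : X ⟶ W} (hu : h ≫ u⟦(1 : ℤ)⟧' = 0) :
    ∃ v : Y ⟶ W, u = f ≫ v := by
  obtain ⟨v, hv⟩ : ∃ v : Y⟦(1 : ℤ)⟧ ⟶ W⟦(1 : ℤ)⟧, u⟦(1 : ℤ)⟧' = (-f⟦(1 : ℤ)⟧') ≫ v :=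
    Triangle.yoneda_exact₃ _ (rot_of_distTriang _ hT) (u⟦(1 : ℤ)⟧') hu
  refine ⟨-(shiftFunctor T (1 : ℤ)).preimage v, (shiftFunctor T (1 : ℤ)).map_injective ?_⟩
  rw [hv]
  simp

end Exactness

/-- `Y` is an iterated extension of `E⟦k⟧, E⟦k - (d - 1)⟧, …, E⟦k - r * (d - 1)⟧`, with all
consecutive extensions nontrivial. -/
def IsString (E : T) (d : ℤ) : ℕ → ℤ → T → Prop
  | 0, k, Y => IsShift E k Y
  | r + 1, k, Y => ∃ (A C : T) (i : A ⟶ Y) (p : Y ⟶ C) (w : C ⟶ A⟦(1 : ℤ)⟧),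
      Triangle.mk i p w ∈ distTriang T ∧ IsShift E k A ∧ IsString E d r (k - (d - 1)) C ∧ w ≠ 0

namespace IsString

variable {d : ℤ} {E : T}

lemma shift {r : ℕ} {k : ℤ} {Y : T} (h : IsString E d r k Y) (n m : ℤ) (hm : k + n = m) :
    IsString E d r m (Y⟦n⟧) := by
  induction r generalizing k m Y with
  | zero => exact IsShift.shift h n m hm
  | succ r ih =>
    obtain ⟨A, C, i, p, w, hT, hA, hC, hw⟩ := h
    refine ⟨_, _, _, _, _, Triangle.shift_distinguished _ hT n, hA.shift n m hm,
      ih hC _ (by lia), fun h => hw ?_⟩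
    apply (shiftFunctor T n).map_injective
    have h' : n.negOnePow • w⟦n⟧' ≫ (shiftFunctorComm T 1 n).hom.app A = 0 := h
    rwa [smul_eq_zero_iff_eq, Preadditive.IsIso.comp_right_eq_zero,
      ← (shiftFunctor T n).map_zero] at h'

lemma generates {r : ℕ} {k : ℤ} {Y : T} (h : IsString E d r k Y) : Generates E Y := by
  induction r generalizing k Y with
  | zero => exact Generates.of_iso h.some.symm (Generates.shift _ _ Generates.self)
  | succ r ih =>
    obtain ⟨A, C, i, p, w, hT, hA, hC, hw⟩ := h
    exact Generates.ext _ hT (Generates.of_iso hA.some.symm (Generates.shift _ _ Generates.self))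
      (ih hC)

/-- If no shift of `E` occurring in `Y` maps to `W`, then neither does `Y`. -/
lemma hom_eq_zero {r : ℕ} {k : ℤ} {Y W : T} (h : IsString E d r k Y)
    (hW : ∀ j : ℕ, j ≤ r → NoHom E (k - j * (d - 1)) W) (f : Y ⟶ W) : f = 0 := by
  induction r generalizing k Y with
  | zero => exact hW 0 le_rfl (by simpa [IsString] using h) f
  | succ r ih =>
    obtain ⟨A, C, i, p, w, hT, hA, hC, hw⟩ := h
    obtain ⟨g, rfl⟩ := exists_eq_mor₂_comp hT (u := f) (hW 0 (by simp) (by simpa using hA) _)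
    have : g = 0 := ih hC (fun j hj => by
      have := hW (j + 1) (by lia)
      convert this using 1
      push_cast
      ring) g
    simp [this]

/-- `i : A ⟶ Y` is a nonzero map from `E⟦k⟧` through which all others factor. -/
def IsBottom (E : T) (k : ℤ) {A Y : T} (i : A ⟶ Y) : Prop :=
  IsShift E k A ∧ i ≠ 0 ∧ ∀ ⦃A' : T⦄, IsShift E k A' → ∀ f : A' ⟶ Y, ∃ g : A' ⟶ A, f = g ≫ i

lemma IsBottom.of_ne_zero (hE : IsSpherical d E) {k : ℤ} {A A' Y : T} {i : A ⟶ Y}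
    (hi : IsBottom E k i) {i' : A' ⟶ Y} (hA' : IsShift E k A') (hi' : i' ≠ 0) :
    IsBottom E k i' := by
  refine ⟨hA', hi', fun B hB f => ?_⟩
  obtain ⟨g, rfl⟩ := hi.2.2 hA' i'
  obtain ⟨f', rfl⟩ := hi.2.2 hB f
  have := hE.isIso_of_isShift hA' hi.1 (f := g) (by rintro rfl; simp at hi')
  exact ⟨f' ≫ inv g, by simp⟩

/-- A morphism out of a string is determined by its restriction to the bottom. -/
lemma eq_zero_of_bottom_comp (hE : IsSpherical d E) {r : ℕ} {k : ℤ} {A Y W : T}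
    (h : IsString E d r k Y) {i : A ⟶ Y} (hi : IsBottom E k i)
    (hW : ∀ j : ℕ, 1 ≤ j → j ≤ r → NoHom E (k - j * (d - 1)) W) {f : Y ⟶ W}
    (hf : i ≫ f = 0) : f = 0 := by
  cases r with
  | zero =>
    have := hE.isIso_of_isShift hi.1 h hi.2.1
    rwa [Preadditive.IsIso.comp_left_eq_zero] at hf
  | succ r =>
    obtain ⟨A', C, i', p, w, hT, hA', hC, hw⟩ := h
    obtain ⟨g, hg⟩ := hi.2.2 hA' i'
    obtain ⟨q, rfl⟩ := exists_eq_mor₂_comp hT (u := f) (by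
      rw [hg, Category.assoc, hf, comp_zero])
    have : q = 0 := hC.hom_eq_zero (fun j hj => by
      have := hW (j + 1) (by lia) (by lia)
      convert this using 1
      push_cast
      ring) q
    simp [this]

end IsString
namespace IsSpherical

variable {d : ℤ} {E : T}

/-- Maps from a shift of `E` to a string vanish up to the last extreme degree except in the first
one, where they all factor through a single nonzero map. -/
lemma string_aux [HomFiniteBounded T] (hd : 2 ≤ d) (hE : IsSpherical d E) (r : ℕ) :
    ∀ (k : ℤ) (Y : T), IsString E d r k Y →
      (∀ n : ℤ, n ≠ 0 → n < r * (d - 1) + d → NoHom E (k - n) Y) ∧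
        ∃ (A : T) (i : A ⟶ Y), IsString.IsBottom E k i := by
  induction r with
  | zero =>
    intro k Y hY
    refine ⟨fun n hn hn' B hB f => hE.eq_zero_of_isShift hB hY (by lia) (by
      simp at hn'
      lia) f, Y, 𝟙 Y, hY, fun h => ?_, fun A' hA' f => ⟨f, by simp⟩⟩
    refine hE.not_isZero ?_
    have h0 : IsZero Y := (IsZero.iff_id_eq_zero Y).2 h
    obtain ⟨e⟩ := (hY.shift (-k) 0 (by lia)).iso (isShift_zero E)
    exact ((shiftFunctor T (-k)).map_isZero h0).of_iso e.symm
  | succ r ih =>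
    intro k Y hY
    obtain ⟨A, C, i, p, w, hT, hA, hC, hw⟩ := hY
    obtain ⟨hCv, A', b, hb⟩ := ih _ _ hC
    have hbw : ∀ {B : T} {f : B ⟶ C}, IsShift E (k - (d - 1)) B → f ≠ 0 → f ≫ w ≠ 0 := by
      intro B f hB hf h
      refine hw (hC.eq_zero_of_bottom_comp hE (hb.of_ne_zero hE hB hf) (fun j hj _ B hB f => ?_) h)
      have hj' : (1 : ℤ) ≤ j := by exact_mod_cast hj
      exact hE.eq_zero_of_isShift hB (hA.shift 1 (k + 1) rfl) (by nlinarith) (by nlinarith) f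
    have hpw : p ≫ w = 0 := comp_distTriang_mor_zero₂₃ _ hT
    refine ⟨fun n hn hn' B hB f => ?_, A, i, hA, ?_, fun B hB f => ?_⟩
    · have hfp : f ≫ p = 0 := by
        by_cases hns : n = d - 1
        · subst hns
          by_contra hf
          exact hbw hB hf (by rw [Category.assoc, hpw, comp_zero])
        · refine hCv (n - (d - 1)) (by lia) ?_ ?_ _
          · push_cast at hn'
            linarith
          · convert hB using 1
            ring
      obtain ⟨g, rfl⟩ := exists_eq_comp_mor₁ hT hfp
      by_cases hnd : n = d
      · subst hnd
        obtain ⟨θ⟩ := (hB.shift 1 (k - (n - 1)) (by lia)).iso hb.1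
        obtain ⟨l, hl⟩ := hE.exists_smul_eq (hB.shift 1 (k - (n - 1)) (by lia))
          (hA.shift 1 (k + 1) rfl) (f := θ.hom ≫ b ≫ w) (by
            rw [Ne, Preadditive.IsIso.comp_left_eq_zero]
            exact hbw hb.1 hb.2.1) (g⟦(1 : ℤ)⟧')
        have hwi : w ≫ i⟦(1 : ℤ)⟧' = 0 := comp_distTriang_mor_zero₃₁ _ hT
        apply (shiftFunctor T (1 : ℤ)).map_injective
        rw [Functor.map_comp, hl, Functor.map_zero]
        simp [hwi]
      · rw [hE.eq_zero_of_isShift hB hA (by lia) (by lia) g, zero_comp]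
    · rintro rfl
      obtain ⟨v, hv⟩ : ∃ v : A⟦(1 : ℤ)⟧ ⟶ C, 𝟙 _ = v ≫ w :=
        Triangle.coyoneda_exact₁ _ hT (𝟙 (A⟦(1 : ℤ)⟧)) (by
          change 𝟙 _ ≫ (0 : A ⟶ Y)⟦(1 : ℤ)⟧' = 0
          simp)
      have hv0 : v = 0 := hCv (-d) (by lia) (by nlinarith) (by
        convert hA.shift 1 (k + 1) rfl using 1
        ring) v
      refine hw ?_
      rw [← Category.comp_id w, hv, hv0]
      simp
    · have hfp : f ≫ p = 0 := hCv (-(d - 1)) (by lia) (by nlinarith) (by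
        convert hB using 1
        ring) _
      exact exists_eq_comp_mor₁ hT hfp

end IsSpherical

namespace IsString

variable {d : ℤ} {E : T}

lemma noHom [HomFiniteBounded T] (hd : 2 ≤ d) (hE : IsSpherical d E) {r : ℕ} {k : ℤ} {Y : T}
    (h : IsString E d r k Y) {m : ℤ} (h0 : m ≠ k) (hm : k - m < r * (d - 1) + d) :
    NoHom E m Y := by
  simpa using (hE.string_aux hd r k Y h).1 (k - m) (by lia) hm

lemma exists_isBottom [HomFiniteBounded T] (hd : 2 ≤ d) (hE : IsSpherical d E) {r : ℕ} {k : ℤ}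
    {Y : T} (h : IsString E d r k Y) : ∃ (A : T) (i : A ⟶ Y), IsBottom E k i :=
  (hE.string_aux hd r k Y h).2

lemma isBottom [HomFiniteBounded T] (hd : 2 ≤ d) (hE : IsSpherical d E) {r : ℕ} {k : ℤ}
    {A Y : T} (h : IsString E d r k Y) {i : A ⟶ Y} (hA : IsShift E k A) (hi : i ≠ 0) :
    IsBottom E k i := by
  obtain ⟨A', i', hi'⟩ := h.exists_isBottom hd hE
  exact hi'.of_ne_zero hE hA hi

lemma exists_ne_zero [HomFiniteBounded T] [CalabiYau T d] (hd : 2 ≤ d) (hE : IsSpherical d E)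
    {r : ℕ} {k : ℤ} {Y B : T} (h : IsString E d r k Y) (hB : IsShift E (k + d) B) :
    ∃ w : Y ⟶ B, w ≠ 0 := by
  obtain ⟨A, i, hA, hi, -⟩ := h.exists_isBottom hd hE
  by_contra! hall
  refine hi (CalabiYau.nondegen_left (d := d) _ _ i fun g => ?_)
  obtain ⟨e⟩ := (hA.shift d _ rfl).iso hB
  have : g = 0 := by rw [← cancel_mono e.hom, hall (g ≫ e.hom), zero_comp]
  rw [this, comp_zero, map_zero]

lemma exists_smul_eq [HomFiniteBounded T] (hd : 2 ≤ d) (hE : IsSpherical d E)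
    {r : ℕ} {k : ℤ} {Y B : T} (h : IsString E d r k Y) (hB : IsShift E (k + d) B)
    {w : Y ⟶ B} (hw : w ≠ 0) (w' : Y ⟶ B) : ∃ l : ℂ, w' = l • w := by
  obtain ⟨A, i, hi⟩ := h.exists_isBottom hd hE
  have key : ∀ {f : Y ⟶ B}, i ≫ f = 0 → f = 0 := fun {f} hf =>
    h.eq_zero_of_bottom_comp hE hi (fun j hj _ A hA f => by
      have hj' : (1 : ℤ) ≤ j := by exact_mod_cast hj
      exact hE.eq_zero_of_isShift hA hB (by nlinarith) (by nlinarith) f) hf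
  obtain ⟨l, hl⟩ := hE.exists_smul_eq hi.1 hB (fun h0 => hw (key h0)) (i ≫ w')
  refine ⟨l, sub_eq_zero.1 (key ?_)⟩
  rw [Preadditive.comp_sub, hl, Linear.comp_smul, sub_self]

lemma isIso_of_ne_zero [HomFiniteBounded T] (hd : 2 ≤ d) (hE : IsSpherical d E)
    {r : ℕ} {k : ℤ} {Y Y' : T} (h : IsString E d r k Y) (h' : IsString E d r k Y')
    {f : Y ⟶ Y'} (hf : f ≠ 0) : IsIso f := by
  induction r generalizing k Y Y' with
  | zero => exact hE.isIso_of_isShift h h' hf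
  | succ r ih =>
    have hY' := h'
    obtain ⟨A, C, i, p, w, hT, hA, hC, hw⟩ := h
    obtain ⟨A', C', i', p', w', hT', hA', hC', hw'⟩ := h'
    have hif : i ≫ f ≠ 0 := by
      intro h0
      obtain ⟨g, rfl⟩ := exists_eq_mor₂_comp hT h0
      refine hf ?_
      rw [hC.hom_eq_zero (fun j hj => hY'.noHom hd hE ?_ ?_) g, comp_zero]
      · have : (0 : ℤ) ≤ j := by positivity
        nlinarith
      · have : (j : ℤ) ≤ r := by exact_mod_cast hj
        push_cast
        nlinarith
    obtain ⟨φ, hφ⟩ := exists_eq_comp_mor₁ hT' (u := i ≫ f)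
      (hC'.noHom hd hE (by lia) (by nlinarith) hA _)
    have hφi : IsIso φ := hE.isIso_of_isShift hA hA' (by
      rintro rfl
      simp [hφ] at hif)
    obtain ⟨c, hc₁, hc₂⟩ := complete_distinguished_triangle_morphism _ _ hT hT' φ f hφ
    have hci : IsIso c := ih hC hC' (by
      rintro rfl
      refine hw ?_
      have h0 : w ≫ φ⟦(1 : ℤ)⟧' = 0 := hc₂.trans zero_comp
      rwa [Preadditive.IsIso.comp_right_eq_zero] at h0)
    exact isIso₂_of_isIso₁₃ (Triangle.homMk (Triangle.mk i p w) (Triangle.mk i' p' w') φ f c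
      hφ hc₁ hc₂) hT hT' hφi hci

lemma nonempty_iso [HomFiniteBounded T] (hd : 2 ≤ d) (hE : IsSpherical d E)
    {r : ℕ} {k : ℤ} {Y Y' : T} (h : IsString E d r k Y) (h' : IsString E d r k Y') :
    Nonempty (Y ≅ Y') := by
  induction r generalizing k Y Y' with
  | zero => exact IsShift.iso h h'
  | succ r ih =>
    obtain ⟨A, C, i, p, w, hT, hA, hC, hw⟩ := h
    obtain ⟨A', C', i', p', w', hT', hA', hC', hw'⟩ := h'
    obtain ⟨θ⟩ := hA.iso hA'
    obtain ⟨γ⟩ := ih hC hC'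
    have hne : γ.hom ≫ w' ≠ 0 := by rwa [Ne, Preadditive.IsIso.comp_left_eq_zero]
    obtain ⟨l, hl⟩ := hC.exists_smul_eq hd hE (by
      convert hA'.shift 1 (k + 1) rfl using 1
      ring) hne (w ≫ θ.hom⟦(1 : ℤ)⟧')
    have hl0 : l ≠ 0 := by
      rintro rfl
      rw [zero_smul, Preadditive.IsIso.comp_right_eq_zero] at hl
      exact hw hl
    have hc : IsIso (l • γ.hom) := ⟨l⁻¹ • γ.inv, by simp [hl0, smul_smul],
      by simp [hl0, smul_smul]⟩
    have hl' : w ≫ θ.hom⟦(1 : ℤ)⟧' = (l • γ.hom) ≫ w' := by rw [hl, Linear.smul_comp]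
    obtain ⟨b, hb₁, hb₂⟩ := complete_distinguished_triangle_morphism₂ _ _ hT hT' θ.hom
      (l • γ.hom) hl'
    have : IsIso b := isIso₂_of_isIso₁₃ (Triangle.homMk (Triangle.mk i p w)
      (Triangle.mk i' p' w') θ.hom b (l • γ.hom) hb₁ hb₂ hl') hT hT'
      (inferInstanceAs (IsIso θ.hom)) hc
    exact ⟨@asIso _ _ _ _ b this⟩

/-- Either a string mapping to `G` extends by one more step, or it splits off `G`. -/
lemma exists_extension_or_retract [HomFiniteBounded T] [CalabiYau T d] (hd : 2 ≤ d)
    (hE : IsSpherical d E) {r : ℕ} {k : ℤ} {A Y G : T} (h : IsString E d r k Y) (hA : IsShift E k A)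
    (i : A ⟶ Y) (z : Y ⟶ G) :
    (∃ (Y' : T) (i' : A ⟶ Y') (z' : Y' ⟶ G), IsString E d (r + 1) k Y' ∧ i' ≫ z' = i ≫ z) ∨
      ∃ t : G ⟶ Y, z ≫ t = 𝟙 Y := by
  have hC : IsString E d r (k - (d - 1)) (Y⟦1 - d⟧) := h.shift _ _ (by ring)
  obtain ⟨w, hw⟩ := hC.exists_ne_zero hd hE (B := A⟦(1 : ℤ)⟧) (hA.shift 1 _ (by ring))
  obtain ⟨Y', i', p, hT⟩ := distinguished_cocone_triangle₂ w
  by_cases hx : w ≫ (i ≫ z)⟦(1 : ℤ)⟧' = 0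
  · obtain ⟨v, hv⟩ := exists_eq_mor₁_comp hT hx
    exact Or.inl ⟨Y', i', v, ⟨A, _, i', p, w, hT, hA, hC, hw⟩, hv.symm⟩
  · right
    obtain ⟨g, hg⟩ : ∃ g : G⟦(1 : ℤ)⟧ ⟶ Y⟦1 - d⟧⟦d⟧, (i ≫ z)⟦(1 : ℤ)⟧' ≫ g ≠ 0 := by
      by_contra! hall
      refine hx (CalabiYau.nondegen_left (d := d) _ _ _ fun g => ?_)
      rw [Category.assoc, hall g, comp_zero, map_zero]
    have hzg : z⟦(1 : ℤ)⟧' ≫ g ≠ 0 := fun h0 => hg (by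
      rw [Functor.map_comp, Category.assoc, h0, comp_zero])
    have := isIso_of_ne_zero hd hE (h.shift 1 (k + 1) rfl) (hC.shift d (k + 1) (by ring)) hzg
    refine ⟨(shiftFunctor T (1 : ℤ)).preimage (g ≫ inv (z⟦(1 : ℤ)⟧' ≫ g)),
      (shiftFunctor T (1 : ℤ)).map_injective ?_⟩
    rw [Functor.map_comp, Functor.map_preimage, ← Category.assoc, IsIso.hom_inv_id,
      CategoryTheory.Functor.map_id]

end IsString
namespace SphericalTwist

variable {d : ℤ} {E : T} (t : SphericalTwist E)

attribute [instance] equiv commShift triangulated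

lemma eval_ne_zero (G : T) (p : Fin (t.m G)) :
    biproduct.ι (fun q : Fin (t.m G) => E⟦-(t.deg G q)⟧) p ≫ (t.decomp G).inv ≫ t.ε.app G ≠ 0 := by
  rw [t.eval G p]
  intro h
  refine (t.bas G (t.deg G p)).ne_zero ⟨p, rfl⟩ (((Equiv.symm_apply_eq _).1 h).trans ?_)
  refine (Adjunction.homEquiv_unit ..).trans ?_
  exact (congrArg _ ((shiftFunctor T (t.deg G p)).map_zero _ _)).trans comp_zero

lemma map_source (hd : 2 ≤ d) (hE : IsSpherical d E) : IsShift E (-d) (t.Φ.obj E) := by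
  have hcard : ∀ n : ℤ, Fintype.card {p : Fin (t.m E) // t.deg E p = n} =
      finrank ℂ (E ⟶ E⟦n⟧) := fun n => (Module.finrank_eq_card_basis (t.bas E n)).symm
  obtain ⟨⟨p, hp⟩, hp'⟩ := Fintype.card_eq_one_iff.1 ((hcard 0).trans hE.1)
  obtain ⟨⟨q, hq⟩, hq'⟩ := Fintype.card_eq_one_iff.1 ((hcard d).trans hE.2.1)
  have hpq : p ≠ q := by
    rintro rfl
    lia
  have hall : ∀ x, x = p ∨ x = q := by
    intro x
    by_cases h0 : t.deg E x = 0
    · exact Or.inl (congrArg Subtype.val (hp' ⟨x, h0⟩))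
    by_cases h1 : t.deg E x = d
    · exact Or.inr (congrArg Subtype.val (hq' ⟨x, h1⟩))
    exact absurd (hE.2.2 _ h0 h1 _) ((t.bas E (t.deg E x)).ne_zero ⟨x, rfl⟩)
  let S : Fin (t.m E) → T := fun x => E⟦-(t.deg E x)⟧
  let e : (⨁ S) ⟶ E := (t.decomp E).inv ≫ t.ε.app E
  let a : t.Φ.obj E ⟶ ⨁ S := t.α.app E ≫ (t.decomp E).hom
  have hae : a ≫ e = 0 := by
    have : t.α.app E ≫ t.ε.app E = 0 := comp_distTriang_mor_zero₁₂ _ (t.dist E)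
    simp [a, e, this]
  have hS : ∀ x, IsShift E (-(t.deg E x)) (S x) := fun x => isShift_shift E _
  have hiso : IsIso (biproduct.ι S p ≫ e) := by
    have h0 := hS p
    rw [hp, neg_zero] at h0
    exact hE.isIso_of_isShift h0 (isShift_zero E) (t.eval_ne_zero E p)
  let s : E ⟶ S p := inv (biproduct.ι S p ≫ e)
  have hs : s ≫ biproduct.ι S p ≫ e = 𝟙 E := IsIso.inv_hom_id _
  have hs' : (biproduct.ι S p ≫ e) ≫ s = 𝟙 _ := IsIso.hom_inv_id _
  have hδ : t.δ.app E = 0 := by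
    have h : t.ε.app E ≫ t.δ.app E = 0 := comp_distTriang_mor_zero₂₃ _ (t.dist E)
    have h' : t.δ.app E = (s ≫ biproduct.ι S p ≫ (t.decomp E).inv) ≫ t.ε.app E ≫ t.δ.app E := by
      have hs2 : (s ≫ biproduct.ι S p ≫ (t.decomp E).inv) ≫ t.ε.app E = 𝟙 E := by
        simpa [e] using hs
      rw [← Category.assoc, hs2]
      exact (Category.id_comp _).symm
    rw [h', h, comp_zero]
  have hmono : Mono (t.α.app E) := Triangle.mono₁ _ (t.dist E) hδ
  let b : S q ⟶ ⨁ S := biproduct.ι S q - (biproduct.ι S q ≫ e) ≫ s ≫ biproduct.ι S p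
  have hbe : b ≫ e = 0 := by
    simp only [b, Preadditive.sub_comp, Category.assoc, hs, Category.comp_id, sub_self]
  obtain ⟨v, hv⟩ : ∃ v : S q ⟶ t.Φ.obj E, b ≫ (t.decomp E).inv = v ≫ t.α.app E :=
    exists_eq_comp_mor₁ (t.dist E) (by rw [Category.assoc]; exact hbe)
  have hva : v ≫ a = b := by
    rw [← Category.assoc, ← hv]
    simp
  have htot : a = (a ≫ biproduct.π S p) ≫ biproduct.ι S p +
      (a ≫ biproduct.π S q) ≫ biproduct.ι S q := by
    have h := biproduct.total (f := S)
    rw [Fintype.sum_eq_add p q hpq (fun x hx => absurd (hall x) (by tauto))] at h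
    conv_lhs => rw [← Category.comp_id a, ← h]
    simp
  have hap : a ≫ biproduct.π S p = -((a ≫ biproduct.π S q) ≫ (biproduct.ι S q ≫ e) ≫ s) := by
    have h : (a ≫ e) ≫ s = 0 := by rw [hae, zero_comp]
    rw [htot, Preadditive.add_comp, Preadditive.add_comp] at h
    rw [eq_neg_iff_add_eq_zero, ← h]
    simp only [Category.assoc] at hs' ⊢
    rw [hs', Category.comp_id]
  have hiv : (a ≫ biproduct.π S q) ≫ v = 𝟙 _ := by
    rw [← cancel_mono (t.α.app E), ← cancel_mono (t.decomp E).hom]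
    rw [Category.assoc, Category.assoc, Category.id_comp]
    change _ ≫ v ≫ a = a
    rw [hva]
    conv_rhs => rw [htot, hap]
    simp only [b, Preadditive.comp_sub, Preadditive.neg_comp, Category.assoc]
    abel
  have hvi : v ≫ a ≫ biproduct.π S q = 𝟙 _ := by
    rw [← Category.assoc, hva]
    simp [b, Preadditive.sub_comp, biproduct.ι_π_ne _ hpq]
  refine IsShift.of_iso (A := S q) ?_ ⟨a ≫ biproduct.π S q, v, hiv, hvi⟩
  simpa [hq] using hS q

lemma map_isShift (hd : 2 ≤ d) (hE : IsSpherical d E) {k : ℤ} {A : T} (hA : IsShift E k A) :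
    IsShift E (k - d) (t.Φ.obj A) :=
  IsShift.of_iso ((t.map_source hd hE).shift k (k - d) (by ring))
    (t.Φ.mapIso hA.some ≪≫ (t.Φ.commShiftIso k).app E)

lemma map_isString (hd : 2 ≤ d) (hE : IsSpherical d E) {r : ℕ} {k : ℤ} {Y : T}
    (h : IsString E d r k Y) : IsString E d r (k - d) (t.Φ.obj Y) := by
  induction r generalizing k Y with
  | zero => exact t.map_isShift hd hE h
  | succ r ih =>
    obtain ⟨A, C, i, p, w, hT, hA, hC, hw⟩ := h
    refine ⟨_, _, _, _, _, t.Φ.map_distinguished _ hT, t.map_isShift hd hE hA, ?_, fun h => hw ?_⟩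
    · have h' : IsString E d r (k - d - (d - 1)) (t.Φ.obj C) := by
        convert ih hC using 1
        ring
      exact h'
    · have h' : t.Φ.map w ≫ (t.Φ.commShiftIso (1 : ℤ)).hom.app A = 0 := h
      rwa [Preadditive.IsIso.comp_right_eq_zero, Functor.map_eq_zero_iff] at h'

/-- The functor `Φ[1]`, target of the connecting transformation of the twist triangle. -/
def shifted : T ⥤ T := t.Φ ⋙ shiftFunctor T (1 : ℤ)

instance : t.shifted.IsEquivalence := inferInstanceAs (t.Φ ⋙ shiftFunctor T (1 : ℤ)).IsEquivalence

instance : t.shifted.Additive := inferInstanceAs (t.Φ ⋙ shiftFunctor T (1 : ℤ)).Additive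

/-- The connecting morphism of the twist triangle. -/
def conn (G : T) : G ⟶ t.shifted.obj G := t.δ.app G

lemma conn_naturality {G G' : T} (f : G ⟶ G') :
    f ≫ t.conn G' = t.conn G ≫ t.shifted.map f := t.δ.naturality f

lemma shifted_isString (hd : 2 ≤ d) (hE : IsSpherical d E) {r : ℕ} {k : ℤ} {Y : T}
    (h : IsString E d r k Y) : IsString E d r (k - (d - 1)) (t.shifted.obj Y) :=
  (t.map_isString hd hE h).shift 1 _ (by ring)

lemma shifted_isShift (hd : 2 ≤ d) (hE : IsSpherical d E) {k : ℤ} {A : T}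
    (hA : IsShift E k A) : IsShift E (k - (d - 1)) (t.shifted.obj A) :=
  t.shifted_isString hd hE (r := 0) hA

lemma shifted_noHom (hd : 2 ≤ d) (hE : IsSpherical d E) {k : ℤ} {G : T} (h : NoHom E k G) :
    NoHom E (k - (d - 1)) (t.shifted.obj G) := by
  intro B hB f
  obtain ⟨e⟩ := hB.iso (t.shifted_isShift hd hE (isShift_shift E k))
  have h0 := h (isShift_shift E k) (t.shifted.preimage (e.inv ≫ f))
  have h1 : e.inv ≫ f = 0 := by rw [← t.shifted.map_preimage (e.inv ≫ f), h0, Functor.map_zero]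
  rwa [Preadditive.IsIso.comp_left_eq_zero] at h1

/-- The `n`-fold iteration of the connecting transformation annihilates `f`. -/
def Annihilates : ℕ → ∀ {A G : T}, (A ⟶ G) → Prop
  | 0, _, _, f => f = 0
  | n + 1, _, G, f => Annihilates n (f ≫ t.conn G)

variable {t}

lemma Annihilates.precomp {n : ℕ} {A B G : T} {f : A ⟶ G} (h : t.Annihilates n f) (g : B ⟶ A) :
    t.Annihilates n (g ≫ f) := by
  induction n generalizing G with
  | zero =>
    have h : f = 0 := h
    simp [Annihilates, h]
  | succ n ih =>
    have h := ih (f := f ≫ t.conn G) h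
    rwa [← Category.assoc] at h

lemma Annihilates.postcomp {n : ℕ} {A G G' : T} {f : A ⟶ G} (h : t.Annihilates n f) (g : G ⟶ G') :
    t.Annihilates n (f ≫ g) := by
  induction n generalizing G G' with
  | zero =>
    have h : f = 0 := h
    simp [Annihilates, h]
  | succ n ih =>
    have h := ih (f := f ≫ t.conn G) h (t.shifted.map g)
    rwa [Category.assoc, ← conn_naturality, ← Category.assoc] at h

lemma Annihilates.of_id {n : ℕ} {A G : T} (h : t.Annihilates n (𝟙 A)) (f : A ⟶ G) :
    t.Annihilates n f := by
  simpa using h.postcomp f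

lemma Annihilates.extension {n m : ℕ} {A Y C : T} {i : A ⟶ Y} {p : Y ⟶ C} {w : C ⟶ A⟦(1 : ℤ)⟧}
    (hT : Triangle.mk i p w ∈ distTriang T) (hC : t.Annihilates m (𝟙 C)) {G : T} {f : Y ⟶ G}
    (hf : t.Annihilates n (i ≫ f)) : t.Annihilates (m + n) f := by
  induction n generalizing G with
  | zero =>
    obtain ⟨g, rfl⟩ := exists_eq_mor₂_comp hT hf
    exact (hC.of_id g).precomp p
  | succ n ih => exact ih (f := f ≫ t.conn G) (by rw [← Category.assoc]; exact hf)

/-- A quotient map with fibre `E⟦k⟧` does not affect annihilation of maps to objects receiving no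
map from shifts of `E` above `k`. -/
lemma Annihilates.of_quotient (hd : 2 ≤ d) (hE : IsSpherical d E) {n : ℕ} {k : ℤ} {A Y C : T}
    {i : A ⟶ Y} {p : Y ⟶ C} {w : C ⟶ A⟦(1 : ℤ)⟧}
    (hT : Triangle.mk i p w ∈ distTriang T) (hA : IsShift E k A) {G : T}
    (hG : ∀ j > k, NoHom E j G) {f : C ⟶ G} (hf : t.Annihilates n (p ≫ f)) :
    t.Annihilates n f := by
  induction n generalizing G with
  | zero =>
    obtain ⟨g, rfl⟩ : ∃ g : A⟦(1 : ℤ)⟧ ⟶ G, f = w ≫ g := Triangle.yoneda_exact₃ _ hT f hf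
    rw [hG (k + 1) (by lia) (hA.shift 1 _ rfl) g]
    simp [Annihilates]
  | succ n ih =>
    refine ih (f := f ≫ t.conn G) (fun j hj => ?_) (by rw [← Category.assoc]; exact hf)
    simpa using t.shifted_noHom hd hE (hG (j + (d - 1)) (by lia))

variable (t)

lemma eq_zero_of_annihilates {G A : T} {n : ℕ} (hd : 2 ≤ d) (hE : IsSpherical d E)
    (hG : ∀ j, NoHom E j G) {f : A ⟶ G} (hf : t.Annihilates n f) : f = 0 := by
  induction n generalizing G with
  | zero => exact hf
  | succ n ih =>
    have h : f ≫ t.δ.app G = 0 := ih (f := f ≫ t.conn G) (fun j => by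
      simpa using t.shifted_noHom hd hE (hG (j + (d - 1)))) hf
    have hε : t.ε.app G = 0 := by
      rw [← cancel_epi (t.decomp G).inv, comp_zero]
      refine biproduct.hom_ext' _ _ fun p => ?_
      rw [comp_zero]
      exact hG _ (isShift_shift E _) _
    obtain ⟨g, rfl⟩ := exists_eq_comp_mor₂ (t.dist G) h
    rw [hε]
    exact comp_zero

lemma conn_ne_zero [HomFiniteBounded T] (hd : 2 ≤ d) (hE : IsSpherical d E) {r : ℕ} {k : ℤ}
    {Y : T} (h : IsString E d (r + 1) k Y) : t.conn Y ≠ 0 := by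
  intro hδ
  obtain ⟨s, hs⟩ : ∃ s : Y ⟶ t.Ψ.obj Y, 𝟙 Y = s ≫ t.ε.app Y :=
    exists_eq_comp_mor₂ (t.dist Y) (u := 𝟙 Y) (by
      change 𝟙 Y ≫ t.conn Y = 0
      rw [hδ, comp_zero])
  have h' := h
  obtain ⟨A, C, i, p, w, hT, hA, hC, hw⟩ := h
  let S : Fin (t.m Y) → T := fun x => E⟦-(t.deg Y x)⟧
  have hi : ∀ {i' : A ⟶ Y} (ρ : Y ⟶ A), i' = 0 ∨ i ≫ ρ ≫ i' = 0 := by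
    intro i' ρ
    by_contra! hne
    have : IsIso (i ≫ ρ) := hE.isIso_of_isShift hA hA (fun h0 => hne.2 (by
      rw [← Category.assoc, h0, zero_comp]))
    have hwi : w ≫ i⟦(1 : ℤ)⟧' = 0 := comp_distTriang_mor_zero₃₁ _ hT
    refine hw ?_
    have h0 : w ≫ (i ≫ ρ)⟦(1 : ℤ)⟧' = 0 := by
      rw [Functor.map_comp, ← Category.assoc, hwi, zero_comp]
    rwa [Preadditive.IsIso.comp_right_eq_zero] at h0
  have hzero : ∀ x, i ≫ (s ≫ (t.decomp Y).hom ≫ biproduct.π S x) ≫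
      (biproduct.ι S x ≫ (t.decomp Y).inv ≫ t.ε.app Y) = 0 := by
    intro x
    by_cases hk : -(t.deg Y x) = k
    · obtain ⟨e⟩ := hA.iso (B := S x) (hk ▸ isShift_shift E _)
      have := hi (i' := e.hom ≫ biproduct.ι S x ≫ (t.decomp Y).inv ≫ t.ε.app Y)
        ((s ≫ (t.decomp Y).hom ≫ biproduct.π S x) ≫ e.inv)
      rcases this with h0 | h0
      · rw [Preadditive.IsIso.comp_left_eq_zero] at h0
        exact (congrArg (fun u => i ≫ (s ≫ (t.decomp Y).hom ≫ biproduct.π S x) ≫ u) h0).trans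
          (by simp)
      · simpa using h0
    by_cases hkd : -(t.deg Y x) = k + d
    · have h0 : biproduct.ι S x ≫ (t.decomp Y).inv ≫ t.ε.app Y = 0 :=
        h'.noHom hd hE (m := k + d) (by lia) (by
          have : (0 : ℤ) ≤ (r + 1 : ℕ) := by positivity
          nlinarith) (hkd ▸ isShift_shift E _) _
      exact (congrArg (fun u => i ≫ (s ≫ (t.decomp Y).hom ≫ biproduct.π S x) ≫ u) h0).trans
        (by simp)
    · rw [← Category.assoc, hE.eq_zero_of_isShift hA (isShift_shift E _) hk hkd
        (i ≫ s ≫ (t.decomp Y).hom ≫ biproduct.π S x), zero_comp]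
  have hi0 : i = 0 := by
    have h1 : i = i ≫ s ≫ (t.decomp Y).hom ≫ (𝟙 (⨁ S)) ≫ (t.decomp Y).inv ≫ t.ε.app Y := by
      rw [Category.id_comp, Iso.hom_inv_id_assoc, ← hs]
      exact (Category.comp_id i).symm
    rw [h1, ← biproduct.total]
    simp only [Preadditive.sum_comp, Preadditive.comp_sum]
    exact Finset.sum_eq_zero fun x _ => by simpa using hzero x
  obtain ⟨A', i', hA', hi', huniv⟩ := h'.exists_isBottom hd hE
  obtain ⟨g, hg⟩ := exists_eq_comp_mor₁ hT (u := i')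
    (hC.noHom hd hE (by lia) (by
      have : (0 : ℤ) ≤ r := by positivity
      nlinarith) hA' _)
  exact hi' (by rw [hg, hi0, comp_zero])

/-- A string of length `r` whose bottom maps nontrivially to `G`, in extreme degree, is not
annihilated by `r` iterations of the connecting transformation. -/
lemma not_annihilates [HomFiniteBounded T] (hd : 2 ≤ d) (hE : IsSpherical d E) {r : ℕ} {k : ℤ}
    {A Y G : T} (h : IsString E d r k Y) (hA : IsShift E k A) {i : A ⟶ Y} {z : Y ⟶ G}
    (hiz : i ≫ z ≠ 0) (hG : ∀ j > k, NoHom E j G) : ¬ t.Annihilates r z := by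
  induction r generalizing k A Y G with
  | zero =>
    intro hz
    have hz : z = 0 := hz
    exact hiz (by rw [hz, comp_zero])
  | succ r ih =>
    have hY := h
    have hFY := t.shifted_isString hd hE h
    have hi : i ≠ 0 := by
      rintro rfl
      simp at hiz
    have hr : (0 : ℤ) ≤ r := by positivity
    obtain ⟨A₀, C, i₀, p, w, hT, hA₀, hC, hw⟩ := h
    obtain ⟨g, rfl⟩ := exists_eq_comp_mor₁ hT (u := i) (hC.noHom hd hE (by lia) (by nlinarith) hA _)
    have hiz₀ : i₀ ≫ z ≠ 0 := fun h0 => hiz (by rw [Category.assoc, h0, comp_zero])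
    obtain ⟨c, hc⟩ := exists_eq_mor₂_comp hT (u := t.conn Y)
      (hFY.noHom hd hE (by lia) (by push_cast; nlinarith) hA₀ _)
    obtain ⟨B, b, hb⟩ := hC.exists_isBottom hd hE
    have hbc : b ≫ c ≠ 0 := by
      intro h0
      refine t.conn_ne_zero hd hE hY ?_
      rw [hc, hC.eq_zero_of_bottom_comp hE hb (fun j hj hj' => hFY.noHom hd hE ?_ ?_) h0,
        comp_zero]
      · have : (1 : ℤ) ≤ j := by exact_mod_cast hj
        nlinarith
      · have : (j : ℤ) ≤ r := by exact_mod_cast hj'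
        push_cast
        nlinarith
    have hbot := hFY.isBottom hd hE hb.1 hbc
    obtain ⟨φ, hφ⟩ := hbot.2.2 (t.shifted_isShift hd hE hA₀) (t.shifted.map i₀)
    have hne : b ≫ c ≫ t.shifted.map z ≠ 0 := by
      intro h0
      refine hiz₀ ((t.shifted.map_eq_zero_iff).1 ?_)
      rw [Functor.map_comp, hφ, Category.assoc, Category.assoc, h0, comp_zero]
    have hFG : ∀ j > k - (d - 1), NoHom E j (t.shifted.obj G) := fun j hj => by
      simpa using t.shifted_noHom hd hE (hG (j + (d - 1)) (by lia))
    intro hz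
    refine ih hC hb.1 hne hFG (Annihilates.of_quotient hd hE hT hA₀ (fun j hj => hFG j (by lia)) ?_)
    have : z ≫ t.conn G = p ≫ c ≫ t.shifted.map z := by
      rw [conn_naturality, hc, Category.assoc]
    rw [← this]
    exact hz

end SphericalTwist

namespace SphericalTwist

variable {d : ℤ} {E : T} (t : SphericalTwist E)

/-- The connecting transformation of the twist triangle is nilpotent on `G`. -/
def IsNilpotent (G : T) : Prop := ∃ N, t.Annihilates N (𝟙 G)

variable {t}

lemma IsNilpotent.of_retract {G H : T} (h : t.IsNilpotent G) {f : H ⟶ G} {g : G ⟶ H}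
    (hfg : f ≫ g = 𝟙 H) : t.IsNilpotent H := by
  obtain ⟨N, hN⟩ := h
  exact ⟨N, by simpa [hfg] using (hN.of_id g).precomp f⟩

lemma isNilpotent_of_isShift (hd : 2 ≤ d) (hE : IsSpherical d E) {k : ℤ} {A : T}
    (hA : IsShift E k A) : t.IsNilpotent A :=
  ⟨1, by
    change 𝟙 A ≫ t.conn A = 0
    exact hE.eq_zero_of_isShift hA (t.shifted_isShift hd hE hA) (by lia) (by lia) _⟩

lemma isNilpotent_of_generates (hd : 2 ≤ d) (hE : IsSpherical d E) {G : T} (h : Generates E G) :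
    t.IsNilpotent G := by
  have key : ∀ n : ℤ, t.IsNilpotent (G⟦n⟧) := by
    induction h with
    | self => exact fun n => isNilpotent_of_isShift hd hE (isShift_shift E n)
    | of_iso e _ ih =>
      exact fun n => (ih n).of_retract ((shiftFunctor T n).mapIso e).inv_hom_id
    | shift G m _ ih =>
      exact fun n => (ih (m + n)).of_retract ((shiftFunctorAdd T m n).app G).inv_hom_id
    | ext Tr hT _ _ ih₁ ih₃ =>
      intro n
      obtain ⟨N₁, h₁⟩ := ih₁ n
      obtain ⟨N₃, h₃⟩ := ih₃ n
      exact ⟨_, Annihilates.extension (Triangle.shift_distinguished _ hT n) h₃ (h₁.of_id _)⟩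
  exact (key 0).of_retract ((shiftFunctorZero T ℤ).app G).inv_hom_id

lemma annihilates_of_shift {G Y : T} (e : Nonempty (t.Φ.obj G ≅ G⟦-d⟧)) (n : ℕ) (k : ℤ)
    (hY : Nonempty (Y ≅ G⟦-(k * (d - 1))⟧))
    (h : ∀ f : G ⟶ G⟦-((k + n) * (d - 1))⟧, f = 0) (f : G ⟶ Y) : t.Annihilates n f := by
  obtain ⟨eY⟩ := hY
  induction n generalizing k Y with
  | zero =>
    rw [Nat.cast_zero, add_zero] at h
    have h0 := h (f ≫ eY.hom)
    rwa [Preadditive.IsIso.comp_right_eq_zero] at h0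
  | succ n ih =>
    refine ih (f := f ≫ t.conn Y) (k + 1) ?_ ?_
    · rw [show k + 1 + (n : ℤ) = k + (n + 1 : ℕ) by push_cast; ring]
      exact h
    · exact (shiftFunctor T (1 : ℤ)).mapIso (t.Φ.mapIso eY ≪≫ (t.Φ.commShiftIso _).app G ≪≫
        (shiftFunctor T _).mapIso e.some ≪≫ ((shiftFunctorAdd T (-d) _).app G).symm) ≪≫
          ((shiftFunctorAdd' T _ 1 _ (by ring)).app G).symm

lemma isNilpotent_of_iso [HomFiniteBounded T] (hd : 2 ≤ d) {G : T}
    (e : Nonempty (t.Φ.obj G ≅ G⟦-d⟧)) : t.IsNilpotent G := by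
  obtain ⟨N, hN⟩ := HomFiniteBounded.bounded G G
  refine ⟨N + 1, annihilates_of_shift e (N + 1) 0
    ⟨((shiftFunctorZero' T _ (by simp)).app G).symm⟩ (hN _ ?_) _⟩
  rw [abs_neg, lt_abs]
  left
  push_cast
  nlinarith

end SphericalTwist

lemma generates_of_isZero {E Z : T} (hZ : IsZero Z) : Generates E Z := by
  have h := rot_of_distTriang _ (contractible_distinguished E)
  refine .of_iso ?_ (Generates.ext _ h .self (.shift E 1 .self))
  exact (isZero_zero T).iso hZ

lemma exists_greatest_hom [HomFiniteBounded T] {E G : T} (h : ∃ k, ¬ NoHom E k G) :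
    ∃ k, ¬ NoHom E k G ∧ ∀ j > k, NoHom E j G := by
  obtain ⟨N, hN⟩ := HomFiniteBounded.bounded E G
  have hb : ∀ k, ¬ NoHom E k G → k ≤ N := by
    intro k hk
    by_contra! hlt
    refine hk fun A hA f => ?_
    have h0 := hN (-k) (by rw [abs_neg, lt_abs]; exact Or.inl hlt)
      ((((hA.shift (-k) 0 (by lia)).some ≪≫ (isShift_zero E).some.symm).inv ≫ f⟦-k⟧'))
    rwa [Preadditive.IsIso.comp_left_eq_zero, Functor.map_eq_zero_iff] at h0
  obtain ⟨k, hk, hk'⟩ := Int.exists_greatest_of_bdd ⟨N, hb⟩ h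
  refine ⟨k, hk, fun j hj => ?_⟩
  by_contra hj'
  exact absurd (hk' j hj') (by lia)

lemma exists_string_retract [HomFiniteBounded T] {d : ℤ} [CalabiYau T d] (hd : 2 ≤ d) {E : T}
    (hE : IsSpherical d E) (t : SphericalTwist E) {G : T} (hG : t.IsNilpotent G)
    (h : ∃ k, ¬ NoHom E k G) :
    ∃ (r : ℕ) (k : ℤ) (Y : T) (z : Y ⟶ G) (s : G ⟶ Y), IsString E d r k Y ∧ z ≫ s = 𝟙 Y := by
  obtain ⟨k, hk, hk'⟩ := exists_greatest_hom h
  simp only [NoHom, not_forall] at hk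
  obtain ⟨A, hA, x, hx⟩ := hk
  by_contra! hno
  have key : ∀ r : ℕ, ∃ (Y : T) (i : A ⟶ Y) (z : Y ⟶ G), IsString E d r k Y ∧ i ≫ z = x := by
    intro r
    induction r with
    | zero => exact ⟨A, 𝟙 A, x, hA, Category.id_comp x⟩
    | succ r ih =>
      obtain ⟨Y, i, z, hY, rfl⟩ := ih
      exact (hY.exists_extension_or_retract hd hE hA i z).resolve_right
        fun ⟨s, hs⟩ => hno r k Y z s hY hs
  obtain ⟨N, hN⟩ := hG
  obtain ⟨Y, i, z, hY, rfl⟩ := key N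
  have hz : t.Annihilates N z := by simpa using hN.precomp z
  exact t.not_annihilates hd hE hY hA hx hk' hz

lemma IsString.not_isZero {d : ℤ} (hd : 2 ≤ d) {E : T} (hE : IsSpherical d E)
    [HomFiniteBounded T] {r : ℕ} {k : ℤ} {Y : T} (h : IsString E d r k Y) : ¬ IsZero Y := by
  obtain ⟨A, i, -, hi, -⟩ := h.exists_isBottom hd hE
  exact fun h0 => hi (h0.eq_of_tgt _ _)

lemma exists_biprod_of_retract {Y G : T} {z : Y ⟶ G} {s : G ⟶ Y} (h : z ≫ s = 𝟙 Y) :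
    ∃ C : T, Nonempty (G ≅ Y ⊞ C) := by
  obtain ⟨C, p, w, hT⟩ := distinguished_cocone_triangle z
  have : IsSplitMono z := ⟨⟨⟨s, h⟩⟩⟩
  obtain ⟨e, -⟩ := exists_iso_binaryBiproduct_of_distTriang _ hT
    (Triangle.mor₃_eq_zero_of_mono₁ _ hT (inferInstanceAs (Mono z)))
  exact ⟨C, ⟨e⟩⟩

lemma finrank_end_lt_of_iso_biprod [HomFiniteBounded T] {G Y C : T} (e : G ≅ Y ⊞ C)
    (hY : ¬ IsZero Y) : finrank ℂ (C ⟶ C) < finrank ℂ (G ⟶ G) := by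
  have := HomFiniteBounded.finite G G
  have := HomFiniteBounded.finite C C
  let p : G ⟶ C := e.hom ≫ biprod.snd
  let i : C ⟶ G := biprod.inr ≫ e.inv
  have hip : i ≫ p = 𝟙 C := by simp [i, p]
  let L : (C ⟶ C) →ₗ[ℂ] (G ⟶ G) := Linear.rightComp ℂ G i ∘ₗ Linear.leftComp ℂ C p
  have hL : ∀ f, L f = (p ≫ f) ≫ i := fun f => rfl
  have hinj : Function.Injective L := by
    intro f g hfg
    rw [hL, hL] at hfg
    have h := congrArg (fun u => i ≫ u ≫ p) hfg
    have hip' : ∀ {H : T} (u : C ⟶ H), i ≫ p ≫ u = u := fun u => by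
      rw [← Category.assoc, hip, Category.id_comp]
    simpa [hip, hip'] using h
  refine lt_of_le_of_ne (LinearMap.finrank_le_finrank_of_injective hinj) fun heq => hY ?_
  obtain ⟨f, hf⟩ := (LinearMap.injective_iff_surjective_of_finrank_eq_finrank heq).1 hinj (𝟙 G)
  rw [hL] at hf
  rw [IsZero.iff_id_eq_zero]
  have h : (biprod.inl ≫ e.inv) ≫ 𝟙 G ≫ (e.hom ≫ biprod.fst) = 𝟙 Y := by simp
  rw [← h, ← hf]
  simp [p]

lemma generates_and_iso_of_isNilpotent [HomFiniteBounded T] {d : ℤ} [CalabiYau T d] (hd : 2 ≤ d)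
    {E : T} (hE : IsSpherical d E) (t : SphericalTwist E) (n : ℕ) :
    ∀ G : T, finrank ℂ (G ⟶ G) = n → t.IsNilpotent G →
      Generates E G ∧ Nonempty (t.Φ.obj G ≅ G⟦-d⟧) := by
  induction n using Nat.strong_induction_on with
  | _ n ih =>
  rintro G rfl hG
  by_cases h : ∃ k, ¬ NoHom E k G
  · obtain ⟨r, k, Y, z, s, hY, hzs⟩ := exists_string_retract hd hE t hG h
    obtain ⟨C, ⟨e⟩⟩ := exists_biprod_of_retract hzs
    obtain ⟨hC, ⟨eC⟩⟩ := ih _ (finrank_end_lt_of_iso_biprod e (hY.not_isZero hd hE)) C rfl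
      (hG.of_retract (f := biprod.inr ≫ e.inv) (g := e.hom ≫ biprod.snd) (by simp))
    refine ⟨.of_iso e.symm (.ext _ (binaryBiproductTriangle_distinguished Y C) hY.generates hC), ?_⟩
    have := preservesBinaryBiproducts_of_preservesBiproducts t.Φ
    have := preservesBinaryBiproducts_of_preservesBiproducts (shiftFunctor T (-d))
    obtain ⟨eY⟩ := (t.map_isString hd hE hY).nonempty_iso hd hE (hY.shift (-d) _ rfl)
    exact ⟨t.Φ.mapIso e ≪≫ t.Φ.mapBiprod Y C ≪≫ biprod.mapIso eY eC ≪≫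
      ((shiftFunctor T (-d)).mapBiprod Y C).symm ≪≫ (shiftFunctor T (-d)).mapIso e.symm⟩
  · push Not at h
    obtain ⟨N, hN⟩ := hG
    have h0 : IsZero G := (IsZero.iff_id_eq_zero G).2 (t.eq_zero_of_annihilates hd hE h hN)
    exact ⟨generates_of_isZero h0,
      ⟨(t.Φ.map_isZero h0).iso ((shiftFunctor T (-d)).map_isZero h0)⟩⟩

/-- Let `X` be a smooth complex projective Calabi-Yau variety of
dimension `d ≥ 2` and `E` a spherical object of `D(X)`.  For any object `G` of
`D(X)`, `Φ_E(G) ≅ G⟦-d⟧` if and only if `G` lies in `⟨E⟩`, the smallest strictly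
full triangulated subcategory of `D(X)` containing `E`. -/
theorem twist_shift_iff_mem_generated
    [HomFiniteBounded T] (d : ℕ) (hd : 2 ≤ d) [CalabiYau T (d : ℤ)]
    {E : T} (hE : IsSpherical (d : ℤ) E) (tE : SphericalTwist E) (G : T) :
    Nonempty (tE.Φ.obj G ≅ G⟦-(d : ℤ)⟧) ↔ Generates E G := by
  have hd' : (2 : ℤ) ≤ d := by exact_mod_cast hd
  exact ⟨fun h => (generates_and_iso_of_isNilpotent hd' hE tE _ G rfl
      (SphericalTwist.isNilpotent_of_iso hd' h)).1,
    fun h => (generates_and_iso_of_isNilpotent hd' hE tE _ G rfl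
      (SphericalTwist.isNilpotent_of_generates hd' hE h)).2⟩

end SphericalPaper
end

section
/- Let X be a smooth complex projective Calabi-Yau variety of dimension d ≥ 2, let E be a spherical object of D(X), and let F be a spherical object lying in ⟨E⟩. Then F ≅ E[i] for some integer i. -/
/-!
This file formalizes a statement from "Commuting reflection functors and
orthogonal spherical objects".  Mathlib does not have bounded derived categories
of coherent sheaves on smooth projective varieties, so the geometric setting is
axiomatized: `T` plays the role of the bounded derived category `D(X)` of a
smooth complex projective variety `X` — a ℂ-linear triangulated category with
finite-dimensional, bounded graded Hom's — and the Calabi-Yau condition is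
expressed by Serre duality in the form of a perfect trace pairing
`Hom(A,B) × Hom(B,A⟦d⟧) → ℂ`.
-/

open CategoryTheory Limits Pretriangulated Module

universe v u

namespace SphericalPaper

variable (T : Type u) [Category.{v} T] [Preadditive T] [Linear ℂ T]
  [HasZeroObject T] [HasShift T ℤ] [∀ n : ℤ, (shiftFunctor T n).Additive]
  [Pretriangulated T] [HasFiniteBiproducts T]

variable {T}

set_option linter.unusedSectionVars false

/-- All morphisms from `A` to `B` vanish. -/
def HomVanishes (A B : T) : Prop := ∀ f : A ⟶ B, f = 0

namespace HomVanishes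

theorem of_iso {A A' B B' : T} (h : HomVanishes A B) (e : A' ≅ A) (e' : B' ≅ B) :
    HomVanishes A' B' := fun f => by
  have := h (e.inv ≫ f ≫ e'.hom)
  rw [← cancel_epi e.inv, ← cancel_mono e'.hom]
  simpa using this

theorem shift {A B : T} (h : HomVanishes A B) (n : ℤ) : HomVanishes (A⟦n⟧) (B⟦n⟧) := fun f => by
  obtain ⟨g, rfl⟩ := (shiftFunctor T n).map_surjective f
  rw [h g, Functor.map_zero]

theorem shift_shift {A B : T} {i j n i' j' : ℤ} (h : HomVanishes (A⟦i⟧) (B⟦j⟧))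
    (hi : i + n = i') (hj : j + n = j') : HomVanishes (A⟦i'⟧) (B⟦j'⟧) :=
  (h.shift n).of_iso ((shiftFunctorAdd' T i n i' hi).app A) ((shiftFunctorAdd' T j n j' hj).app B)

theorem left_of_shift {A B : T} {j n j' : ℤ} (h : HomVanishes A (B⟦j⟧)) (hj : j + n = j') :
    HomVanishes (A⟦n⟧) (B⟦j'⟧) :=
  (h.shift n).of_iso (Iso.refl _) ((shiftFunctorAdd' T j n j' hj).app B)

theorem right_of_shift {A B : T} {i n i' : ℤ} (h : HomVanishes (A⟦i⟧) B) (hi : i + n = i') :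
    HomVanishes (A⟦i'⟧) (B⟦n⟧) :=
  (h.shift n).of_iso ((shiftFunctorAdd' T i n i' hi).app A) (Iso.refl _)

theorem right_of_left_shift {A B : T} {m n : ℤ} (h : HomVanishes (A⟦m⟧) B) (hmn : m + n = 0) :
    HomVanishes A (B⟦n⟧) :=
  (h.right_of_shift hmn).of_iso ((shiftFunctorZero T ℤ).symm.app A) (Iso.refl _)

theorem left_of_right_shift {A B : T} {m n : ℤ} (h : HomVanishes A (B⟦m⟧)) (hmn : m + n = 0) :
    HomVanishes (A⟦n⟧) B :=
  (h.left_of_shift hmn).of_iso (Iso.refl _) ((shiftFunctorZero T ℤ).symm.app B)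

end HomVanishes

/-- Exactness of `Hom(-, W)` at the first object of a distinguished triangle. -/
theorem yoneda_exact₁ (Tr : Triangle T) (hTr : Tr ∈ distTriang T) {W : T} (g : Tr.obj₁ ⟶ W)
    (hg : Tr.mor₃ ≫ g⟦(1 : ℤ)⟧' = 0) : ∃ w : Tr.obj₂ ⟶ W, g = Tr.mor₁ ≫ w := by
  obtain ⟨w, hw⟩ : ∃ w : Tr.obj₂⟦(1 : ℤ)⟧ ⟶ W⟦(1 : ℤ)⟧,
      g⟦(1 : ℤ)⟧' = (-Tr.mor₁⟦(1 : ℤ)⟧') ≫ w :=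
    Triangle.yoneda_exact₃ _ (rot_of_distTriang _ hTr) (g⟦(1 : ℤ)⟧') hg
  obtain ⟨w, rfl⟩ := (shiftFunctor T (1 : ℤ)).map_surjective w
  refine ⟨-w, (shiftFunctor T (1 : ℤ)).map_injective ?_⟩
  simpa using hw

/-- A nonzero endomorphism of an object with one-dimensional endomorphism space is invertible. -/
theorem isIso_of_ne_zero {A : T} (hA : finrank ℂ (A ⟶ A⟦(0 : ℤ)⟧) = 1) {u : A ⟶ A} (hu : u ≠ 0) :
    IsIso u := by
  let e : A ≅ A⟦(0 : ℤ)⟧ := (shiftFunctorZero T ℤ).symm.app A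
  have hne : u ≫ e.hom ≠ 0 := fun h => hu (by
    rw [← cancel_mono e.hom, h, zero_comp])
  obtain ⟨a, ha⟩ := (finrank_eq_one_iff_of_nonzero' _ hne).1 hA e.hom
  have ha' : a • u = 𝟙 A := by
    rw [← cancel_mono e.hom, Linear.smul_comp, ha, Category.id_comp]
  exact ⟨a • 𝟙 A, by simpa using ha', by simpa using ha'⟩

theorem isIso_shift_of_ne_zero {A : T} (hA : finrank ℂ (A ⟶ A⟦(0 : ℤ)⟧) = 1) {n : ℤ}
    {u : A⟦n⟧ ⟶ A⟦n⟧} (hu : u ≠ 0) : IsIso u := by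
  obtain ⟨v, rfl⟩ := (shiftFunctor T n).map_surjective u
  have hv : v ≠ 0 := by
    rintro rfl
    exact hu (Functor.map_zero _ _ _)
  have := isIso_of_ne_zero hA hv
  infer_instance

theorem IsSpherical.homVanishes {d : ℤ} {E : T} (hE : IsSpherical d E) {i j : ℤ} (h : i ≠ j)
    (h' : j ≠ i + d) : HomVanishes (E⟦i⟧) (E⟦j⟧) :=
  HomVanishes.left_of_shift (A := E) (B := E) (j := j - i)
    (hE.2.2 (j - i) (by omega) (by omega)) (by omega)

/-- If `G` has no maps to the shifts `E⟦i⟧` with `i` below a bound depending on `K ∈ ⟨E⟩`, then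
it has no maps to `K`. -/
theorem Generates.exists_bound {E K : T} (hK : Generates E K) :
    ∃ M : ℤ, ∀ G : T, (∀ i < M, HomVanishes G (E⟦i⟧)) → HomVanishes G K := by
  induction hK with
  | self =>
    exact ⟨1, fun G hG => (hG 0 (by omega)).of_iso (Iso.refl _) ((shiftFunctorZero T ℤ).symm.app E)⟩
  | of_iso e _ ih =>
    obtain ⟨M, hM⟩ := ih
    exact ⟨M, fun G hG => (hM G hG).of_iso (Iso.refl _) e.symm⟩
  | shift K n _ ih =>
    obtain ⟨M, hM⟩ := ih
    refine ⟨M + n, fun G hG => ?_⟩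
    refine (hM (G⟦-n⟧) fun i hi => ?_).right_of_left_shift (by omega)
    exact (hG (i + n) (by omega)).left_of_shift (by omega)
  | ext Tr hTr _ _ ih₁ ih₃ =>
    obtain ⟨M₁, hM₁⟩ := ih₁
    obtain ⟨M₃, hM₃⟩ := ih₃
    refine ⟨max M₁ M₃, fun G hG f => ?_⟩
    obtain ⟨g, rfl⟩ := Triangle.coyoneda_exact₂ _ hTr f (hM₃ G (fun i hi => hG i (by omega)) _)
    rw [hM₁ G (fun i hi => hG i (by omega)) g, zero_comp]

section Orthogonality

variable {d : ℕ} {E F K X : T} {c : ℤ}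

/-- Passing to the fibre of a map `F ⟶ E⟦c⟧`, with `c` the lowest degree in which `F` maps to a
shift of `E`, creates no maps in lower degrees. -/
theorem homVanishes_fibre (hd : 2 ≤ d) (hE : IsSpherical (d : ℤ) E)
    (hF : ∀ i < c, HomVanishes F (E⟦i⟧)) {f : X ⟶ F} {ψ : F ⟶ E⟦c⟧} {h : E⟦c⟧ ⟶ X⟦(1 : ℤ)⟧}
    (hT : Triangle.mk f ψ h ∈ distTriang T) (hψ : ψ ≠ 0) : ∀ i < c, HomVanishes X (E⟦i⟧) := by
  intro i hi g
  have hzero : h ≫ g⟦(1 : ℤ)⟧' = 0 := by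
    by_cases hc : i + 1 = c
    · by_contra hne
      let e : E⟦c⟧ ≅ (E⟦i⟧)⟦(1 : ℤ)⟧ := (shiftFunctorAdd' T i 1 c hc).app E
      have hu : (h ≫ g⟦(1 : ℤ)⟧') ≫ e.inv ≠ 0 := fun h' => hne (by
        rw [← cancel_mono e.inv, h', zero_comp])
      have := isIso_shift_of_ne_zero hE.1 hu
      apply hψ
      rw [← cancel_mono ((h ≫ g⟦(1 : ℤ)⟧') ≫ e.inv), zero_comp]
      have hcomp : ψ ≫ h = 0 := comp_distTriang_mor_zero₂₃ _ hT
      simp [reassoc_of% hcomp]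
    · exact ((hE.homVanishes (i := c) (j := i + 1) (by omega) (by omega)).of_iso (Iso.refl _)
        ((shiftFunctorAdd' T i 1 (i + 1) rfl).symm.app E)) _
  obtain ⟨w, rfl⟩ := yoneda_exact₁ _ hT g hzero
  exact (congrArg (f ≫ ·) (hF i hi w)).trans comp_zero

theorem finrank_fibre_lt [HomFiniteBounded T] (hd : 2 ≤ d) (hE : IsSpherical (d : ℤ) E)
    {f : X ⟶ F} {ψ : F ⟶ E⟦c⟧} {h : E⟦c⟧ ⟶ X⟦(1 : ℤ)⟧}
    (hT : Triangle.mk f ψ h ∈ distTriang T) (hψ : ψ ≠ 0) :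
    finrank ℂ (X ⟶ E⟦c⟧) < finrank ℂ (F ⟶ E⟦c⟧) := by
  have := HomFiniteBounded.finite F (E⟦c⟧)
  let L : (F ⟶ E⟦c⟧) →ₗ[ℂ] (X ⟶ E⟦c⟧) := Linear.leftComp ℂ (E⟦c⟧) f
  have hL : Function.Surjective L := fun g => by
    obtain ⟨w, hw⟩ := yoneda_exact₁ _ hT g
      (((hE.homVanishes (i := c) (j := c + 1) (by omega) (by omega)).of_iso (Iso.refl _)
        ((shiftFunctorAdd' T c 1 (c + 1) rfl).symm.app E)) _)
    exact ⟨w, hw.symm⟩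
  have hker : 0 < finrank ℂ (LinearMap.ker L) := by
    have : Nontrivial (LinearMap.ker L) :=
      ⟨⟨⟨ψ, comp_distTriang_mor_zero₁₂ _ hT⟩, 0, fun h' => hψ (congrArg Subtype.val h')⟩⟩
    exact finrank_pos
  have hrank := L.finrank_range_add_finrank_ker
  rw [LinearMap.range_eq_top.2 hL, finrank_top] at hrank
  omega

/-- Orthogonality of the two halves of `⟨E⟩`: if `F` has no maps to `E⟦i⟧` for `i < c` and
`K ∈ ⟨E⟩` receives no maps from `E⟦j⟧` for `j ≥ c`, then there are no maps from `F` to `K`. -/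
theorem homVanishes_of_orthogonal [HomFiniteBounded T] (hd : 2 ≤ d)
    (hE : IsSpherical (d : ℤ) E) (hgen : Generates E K)
    (hF : ∀ i < c, HomVanishes F (E⟦i⟧)) (hK : ∀ j ≥ c, HomVanishes (E⟦j⟧) K) :
    HomVanishes F K := by
  obtain ⟨M, hM⟩ := hgen.exists_bound
  induction hn : (M - c).toNat generalizing F c with
  | zero => exact hM F fun i hi => hF i (by omega)
  | succ n ihn =>
    induction hr : finrank ℂ (F ⟶ E⟦c⟧) using Nat.strong_induction_on generalizing F with
    | _ r ihr =>
      by_cases hc : HomVanishes F (E⟦c⟧)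
      · refine ihn (c := c + 1) (fun i hi => ?_) (fun j hj => hK j (by omega)) (by omega)
        rcases eq_or_lt_of_le (Int.lt_add_one_iff.1 hi) with rfl | hi
        · exact hc
        · exact hF i hi
      · obtain ⟨ψ, hψ⟩ := not_forall.1 hc
        obtain ⟨X, f, h, hT⟩ := distinguished_cocone_triangle₁ ψ
        intro g
        have hfg : f ≫ g = 0 := ihr _ (hr ▸ finrank_fibre_lt hd hE hT hψ)
          (homVanishes_fibre hd hE hF hT hψ) rfl _
        obtain ⟨w, rfl⟩ := Triangle.yoneda_exact₂ _ hT g hfg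
        exact (congrArg (ψ ≫ ·) (hK c le_rfl w)).trans comp_zero

/-- A nonzero map from `F` to its lowest shift of `E` composes nontrivially with a nonzero map
from that shift of `E` into an object of `⟨E⟩` receiving no maps from higher shifts. -/
theorem comp_ne_zero_of_extremal [HomFiniteBounded T] (hd : 2 ≤ d)
    (hE : IsSpherical (d : ℤ) E) (hgen : Generates E K)
    (hF : ∀ i < c, HomVanishes F (E⟦i⟧)) (hK : ∀ j > c, HomVanishes (E⟦j⟧) K)
    {ψ : F ⟶ E⟦c⟧} (hψ : ψ ≠ 0) {φ : E⟦c⟧ ⟶ K} (hφ : φ ≠ 0) : ψ ≫ φ ≠ 0 := by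
  intro hcomp
  obtain ⟨X, f, h, hT⟩ := distinguished_cocone_triangle₁ φ
  have hX : Generates E X :=
    Generates.ext _ (inv_rot_of_distTriang _ hT) (hgen.shift K (-1)) (Generates.self.shift E c)
  obtain ⟨w, hw⟩ := Triangle.coyoneda_exact₂ _ hT ψ hcomp
  refine hψ (hw.trans ?_)
  rw [homVanishes_of_orthogonal hd hE hX hF (fun j hj g => ?_) w]
  · exact zero_comp
  have hgf : g ≫ f = 0 := by
    rcases eq_or_lt_of_le hj with rfl | hj
    · by_contra hne
      have := isIso_shift_of_ne_zero hE.1 hne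
      apply hφ
      rw [← cancel_epi (g ≫ f), Category.assoc,
        show f ≫ φ = 0 from comp_distTriang_mor_zero₁₂ _ hT, comp_zero, comp_zero]
    · exact hE.homVanishes (by omega) (by omega) _
  apply (shiftFunctor T (1 : ℤ)).map_injective
  obtain ⟨w, hw⟩ := Triangle.coyoneda_exact₁ _ hT (g⟦(1 : ℤ)⟧')
    ((Functor.map_comp _ _ _).symm.trans ((congrArg _ hgf).trans (Functor.map_zero _ _ _)))
  have hw0 : w = 0 := ((hK (j + 1) (by omega)).of_iso
    ((shiftFunctorAdd' T j 1 (j + 1) rfl).symm.app E) (Iso.refl _)) w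
  exact hw.trans ((congrArg (· ≫ h) hw0).trans (zero_comp.trans (Functor.map_zero _ _ _).symm))

end Orthogonality

/-- Let `X` be a smooth complex projective Calabi-Yau variety of
dimension `d ≥ 2`, `E` a spherical object of `D(X)` and `F` a spherical object
lying in `⟨E⟩`.  Then `F ≅ E⟦i⟧` for some integer `i`. -/
theorem spherical_mem_generated_is_shift
    [HomFiniteBounded T] (d : ℕ) (hd : 2 ≤ d) [CalabiYau T (d : ℤ)]
    {E F : T} (hE : IsSpherical (d : ℤ) E) (hF : IsSpherical (d : ℤ) F)
    (hmem : Generates E F) :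
    ∃ i : ℤ, Nonempty (F ≅ E⟦i⟧) := by
  have hne : ¬ HomVanishes F F := fun h => by
    have h0 : finrank ℂ (F ⟶ F⟦(0 : ℤ)⟧) = 0 := by
      have h' := h.of_iso (Iso.refl _) ((shiftFunctorZero T ℤ).app F)
      have : Subsingleton (F ⟶ F⟦(0 : ℤ)⟧) := ⟨fun f g => (h' f).trans (h' g).symm⟩
      exact finrank_zero_of_subsingleton
    have := hF.1
    omega
  obtain ⟨c, hc, hcmin⟩ : ∃ c : ℤ, ¬ HomVanishes F (E⟦c⟧) ∧
      ∀ i, ¬ HomVanishes F (E⟦i⟧) → c ≤ i := by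
    refine Int.exists_least_of_bdd ?_ ?_
    · obtain ⟨N, hN⟩ := HomFiniteBounded.bounded F E
      refine ⟨-N, fun i hi => ?_⟩
      by_contra! hlt
      exact hi (hN i (by rw [abs_of_neg (by omega)]; omega))
    · by_contra! hall
      obtain ⟨M, hM⟩ := hmem.exists_bound
      exact hne (hM F fun i _ => hall i)
  have hcF : ∀ i < c, HomVanishes F (E⟦i⟧) := fun i hi => by
    by_contra hi'
    exact absurd (hcmin i hi') (by omega)
  obtain ⟨j, hjc, hj⟩ : ∃ j ≥ c, ¬ HomVanishes (E⟦j⟧) F := by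
    by_contra! hall
    exact hne (homVanishes_of_orthogonal hd hE hmem hcF hall)
  obtain ⟨m, hm, hmmax⟩ : ∃ m : ℤ, ¬ HomVanishes (E⟦m⟧) F ∧
      ∀ i, ¬ HomVanishes (E⟦i⟧) F → i ≤ m := by
    refine Int.exists_greatest_of_bdd ?_ ⟨j, hj⟩
    obtain ⟨N, hN⟩ := HomFiniteBounded.bounded E F
    refine ⟨N, fun i hi => ?_⟩
    by_contra! hlt
    refine hi (HomVanishes.left_of_right_shift (m := -i) (hN (-i) ?_) (by omega))
    rw [abs_neg, abs_of_pos (by omega)]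
    omega
  have hmF : ∀ i > m, HomVanishes (E⟦i⟧) F := fun i hi => by
    by_contra hi'
    exact absurd (hmmax i hi') (by omega)
  obtain ⟨ψ, hψ⟩ := not_forall.1 hc
  obtain rfl : c = m := by
    by_contra hcm
    have := hmmax j hj
    have hG : ¬ HomVanishes (E⟦c⟧) (F⟦c - m⟧) := fun h => hm <|
      (h.shift (m - c)).of_iso ((shiftFunctorAdd' T c (m - c) m (by omega)).app E)
        ((shiftFunctorCompIsoId T (c - m) (m - c) (by omega)).symm.app F)
    obtain ⟨φ, hφ⟩ := not_forall.1 hG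
    refine comp_ne_zero_of_extremal hd hE (hmem.shift F (c - m)) hcF (fun i hi => ?_) hψ hφ
      (hF.2.2 (c - m) (by omega) (by omega) _)
    exact (hmF (i + m - c) (by omega)).right_of_shift (by omega)
  obtain ⟨φ, hφ⟩ := not_forall.1 hm
  have hψφ := isIso_of_ne_zero hF.1 (comp_ne_zero_of_extremal hd hE hmem hcF hmF hψ hφ)
  have hφψ : φ ≫ ψ ≠ 0 := fun h => hψ <| by
    rw [← cancel_epi (ψ ≫ φ), Category.assoc, h, comp_zero, comp_zero]
  have := isIso_shift_of_ne_zero hE.1 hφψ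
  have : IsSplitMono ψ := IsSplitMono.mk' ⟨φ ≫ inv (ψ ≫ φ), by
    rw [← Category.assoc, IsIso.hom_inv_id]⟩
  have : IsSplitEpi ψ := IsSplitEpi.mk' ⟨inv (φ ≫ ψ) ≫ φ, by
    rw [Category.assoc, IsIso.inv_hom_id]⟩
  have : IsIso ψ := isIso_of_mono_of_isSplitEpi ψ
  exact ⟨c, ⟨asIso ψ⟩⟩

end SphericalPaper
end
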